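/- arXiv:1201.3027 — 2 statements merged into one kernel-verified Lean document; each statement's English description precedes it below -/
import Mathlib

section
/- Let p ≥ 2 be an integer and ζ a real random variable with E{ζ} = 0 and E{|ζ|^{p+2}} < ∞, with cumulants κ₁,…,κ_{p+1}. Let ζ̂ be a centered real Gaussian random variable, independent of ζ, with E{ζ̂²} = E{ζ²}, and for 0 ≤ s ≤ 1 set ζ(s) = s^{1/2} ζ + (1−s)^{1/2} ζ̂. Let Φ : ℝ → ℂ be of class C^{p+2} with bounded derivatives Φ^{(l)}, l = 1,…,p+2. Then E{Φ(ζ)} − E{Φ(ζ̂)} = Σ_{l=2}^{p} (κ_{l+1}/(2·l!)) ∫₀¹ E{Φ^{(l+1)}(ζ(s))} s^{(l−1)/2} ds + ε'_p, where |ε'_p| ≤ C_p · E{|ζ|^{p+2}} · sup_{t∈ℝ} |Φ^{(p+2)}(t)| with C_p = (1 + (3+2p)^{p+2})/(p+1)!. -/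
open MeasureTheory ProbabilityTheory Complex Finset

/-- The `j`-th cumulant of a real random variable `ζ` on a probability space `(Ω, ℙ)`:
`κ_j = i^{-j} (d^j/dt^j) log E{e^{itζ}} |_{t=0}` (principal branch of the logarithm). -/
noncomputable def cumulant {Ω : Type*} [MeasureSpace Ω] (ζ : Ω → ℝ) (j : ℕ) : ℂ :=
  iteratedDeriv j (fun t : ℝ => Complex.log (∫ ω, Complex.exp (Complex.I * t * ζ ω))) 0
    / Complex.I ^ j

lemma norm_sub_taylor_le_of_nonneg (n : ℕ) :
    ∀ (f : ℕ → ℝ → ℂ) {M : ℝ}, (∀ j < n, ∀ x, HasDerivAt (f j) (f (j + 1) x) x) →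
      (∀ x, ‖f n x‖ ≤ M) → ∀ x : ℝ, 0 ≤ x →
      ‖f 0 x - ∑ k ∈ range n, f k 0 * (x : ℂ) ^ k / (k.factorial : ℂ)‖
        ≤ M * x ^ n / n.factorial := by
  induction n with
  | zero => intro f M _ hM x _; simpa using hM x
  | succ n ih =>
    intro f M hd hM x hx
    have key := ih (fun j => f (j + 1)) (fun j hj => hd (j + 1) (by omega)) hM
    have hderiv : ∀ y : ℝ, HasDerivAt
        (fun y : ℝ => f 0 y - ∑ k ∈ range (n + 1), f k 0 * (y : ℂ) ^ k / (k.factorial : ℂ))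
        (f 1 y - ∑ k ∈ range n, f (k + 1) 0 * (y : ℂ) ^ k / (k.factorial : ℂ)) y := by
      intro y
      refine (hd 0 (by omega) y).sub ?_
      simp only [sum_range_succ' _ n]
      simp only [pow_zero, mul_one]
      refine HasDerivAt.add_const _ (HasDerivAt.fun_sum fun k _ => ?_)
      have h := (((hasDerivAt_id y).ofReal_comp.pow (k + 1)).const_mul (f (k + 1) 0)).div_const
        ((k + 1).factorial : ℂ)
      convert! h using 1
      have h1 : ((k : ℂ) + 1) ≠ 0 := by exact_mod_cast Nat.succ_ne_zero k
      have h2 : (k.factorial : ℂ) ≠ 0 := by exact_mod_cast k.factorial_ne_zero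
      simp [Nat.factorial_succ]
      field_simp
    have hB : ∀ y : ℝ, HasDerivAt (fun y : ℝ => M * y ^ (n + 1) / (n + 1).factorial)
        (M * y ^ n / n.factorial) y := by
      intro y
      have h := (((hasDerivAt_id y).pow (n + 1)).const_mul M).div_const ((n + 1).factorial : ℝ)
      convert! h using 1
      have h2 : (n.factorial : ℝ) ≠ 0 := by exact_mod_cast n.factorial_ne_zero
      simp [Nat.factorial_succ]
      field_simp
    refine image_norm_le_of_norm_deriv_right_le_deriv_boundary (a := 0) (b := x)
      (fun y _ => (hderiv y).continuousAt.continuousWithinAt)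
      (fun y _ => (hderiv y).hasDerivWithinAt) ?_ hB (fun y hy => key y hy.1)
      (Set.right_mem_Icc.2 hx)
    simp [sum_range_succ']

lemma norm_sub_taylor_le {n : ℕ} (f : ℕ → ℝ → ℂ) {M : ℝ}
    (hd : ∀ j < n, ∀ x, HasDerivAt (f j) (f (j + 1) x) x) (hM : ∀ x, ‖f n x‖ ≤ M) (x : ℝ) :
    ‖f 0 x - ∑ k ∈ range n, f k 0 * (x : ℂ) ^ k / (k.factorial : ℂ)‖
      ≤ M * |x| ^ n / n.factorial := by
  rcases le_total 0 x with hx | hx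
  · simpa [abs_of_nonneg hx] using norm_sub_taylor_le_of_nonneg n f hd hM x hx
  · have h := norm_sub_taylor_le_of_nonneg n (M := M)
      (fun (j : ℕ) (y : ℝ) => (-1 : ℂ) ^ j * f j (-y)) ?_ ?_
      (-x) (by linarith)
    · rw [abs_of_nonpos hx]
      convert h using 3
      · simp
      · refine sum_congr rfl fun k _ => ?_
        rw [ofReal_neg, neg_pow (x : ℂ)]
        have : ((-1 : ℂ) ^ k) * (-1) ^ k = 1 := by rw [← mul_pow]; simp
        simp only [neg_zero]
        linear_combination (- (f k 0 * (x : ℂ) ^ k / (k.factorial : ℂ))) * this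
    · intro j hj y
      have h := ((hd j hj (-y)).scomp y (hasDerivAt_neg y)).const_mul ((-1 : ℂ) ^ j)
      convert! h using 1
      simp [pow_succ]
    · intro y
      simpa using hM (-y)

lemma integral_mul_gaussianReal_zero {v : NNReal} {g g' : ℝ → ℂ}
    (hg : ∀ x, HasDerivAt g (g' x) x) (hInt : Integrable g (gaussianReal 0 v))
    (hint_mul : Integrable (fun x : ℝ => (x : ℂ) * g x) (gaussianReal 0 v))
    (hInt' : Integrable g' (gaussianReal 0 v)) :
    ∫ x, (x : ℂ) * g x ∂(gaussianReal 0 v) = (v : ℂ) * ∫ x, g' x ∂(gaussianReal 0 v) := by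
  by_cases hv : v = 0
  · subst hv
    simp [gaussianReal_zero_var]
  have hv' : (v : ℝ) ≠ 0 := by exact_mod_cast hv
  have hiff : ∀ h : ℝ → ℂ, Integrable h (gaussianReal 0 v) →
      Integrable (fun x => (gaussianPDFReal 0 v x : ℂ) * h x) := by
    intro h hh
    rw [gaussianReal_of_var_ne_zero _ hv, integrable_withDensity_iff_integrable_smul'
      (measurable_gaussianPDF _ _) (ae_of_all _ fun _ => gaussianPDF_lt_top)] at hh
    simpa [toReal_gaussianPDF] using hh
  have hpdf : ∀ x, HasDerivAt (fun x => (gaussianPDFReal 0 v x : ℂ))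
      (((-(x / v) * gaussianPDFReal 0 v x : ℝ)) : ℂ) x := by
    intro x
    refine HasDerivAt.ofReal_comp ?_
    have h1 : HasDerivAt (fun x : ℝ => -(x - 0) ^ 2 / (2 * (v : ℝ))) (-(x / v)) x := by
      have := ((((hasDerivAt_id x).sub_const 0).pow 2).neg).div_const (2 * (v : ℝ))
      convert! this using 1
      simp
      field_simp
    have h2 := (h1.exp).const_mul (Real.sqrt (2 * Real.pi * v))⁻¹
    convert! h2 using 1
    simp only [gaussianPDFReal]
    ring
  have hibp := integral_mul_deriv_eq_deriv_mul_of_integrable (fun x _ => hpdf x) (fun x _ => hg x)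
    (hiff _ hInt') ?_ (hiff _ hInt)
  · rw [integral_gaussianReal_eq_integral_smul hv, integral_gaussianReal_eq_integral_smul hv]
    simp only [real_smul]
    rw [hibp, ← integral_neg, ← integral_const_mul]
    refine integral_congr_ae (ae_of_all _ fun x => ?_)
    have : (v : ℂ) ≠ 0 := by exact_mod_cast hv
    simp only [ofReal_mul, ofReal_neg, ofReal_div]
    field_simp
  · convert! (hiff _ hint_mul).const_mul (-(v : ℂ)⁻¹) using 2 with x
    simp only [Pi.mul_apply, ofReal_mul, ofReal_neg, ofReal_div]
    have : (v : ℂ) ≠ 0 := by exact_mod_cast hv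
    field_simp

lemma integrable_pow_abs_of_le {ν : Measure ℝ} [IsFiniteMeasure ν] {n k : ℕ} (hk : k ≤ n)
    (h : Integrable (fun x : ℝ => |x| ^ n) ν) : Integrable (fun x : ℝ => |x| ^ k) ν := by
  refine ((integrable_const (1 : ℝ)).add h).mono' (by fun_prop) (ae_of_all _ fun x => ?_)
  have hx := abs_nonneg x
  simp only [norm_pow, Real.norm_eq_abs, abs_abs, Pi.add_apply]
  rcases le_total |x| 1 with h1 | h1
  · have := pow_le_one₀ hx h1 (n := k)
    have := pow_nonneg hx n
    linarith
  · have := pow_le_pow_right₀ h1 hk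
    linarith

lemma integral_pow_abs_mul_le {ν : Measure ℝ} [IsProbabilityMeasure ν] {a b : ℕ}
    (h : Integrable (fun x : ℝ => |x| ^ (a + b)) ν) :
    (∫ x, |x| ^ a ∂ν) * (∫ x, |x| ^ b ∂ν) ≤ ∫ x, |x| ^ (a + b) ∂ν := by
  have ha := integrable_pow_abs_of_le (Nat.le_add_right a b) h
  have hb := integrable_pow_abs_of_le (Nat.le_add_left b a) h
  have key : 0 ≤ ∫ z : ℝ × ℝ, (|z.1| ^ a - |z.2| ^ a) * (|z.1| ^ b - |z.2| ^ b) ∂(ν.prod ν) := by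
    refine integral_nonneg fun z => ?_
    rcases le_total |z.1| |z.2| with h1 | h1
    · exact mul_nonneg_of_nonpos_of_nonpos
        (sub_nonpos.2 (pow_le_pow_left₀ (abs_nonneg _) h1 _))
        (sub_nonpos.2 (pow_le_pow_left₀ (abs_nonneg _) h1 _))
    · exact mul_nonneg (sub_nonneg.2 (pow_le_pow_left₀ (abs_nonneg _) h1 _))
        (sub_nonneg.2 (pow_le_pow_left₀ (abs_nonneg _) h1 _))
  have e : (fun z : ℝ × ℝ => (|z.1| ^ a - |z.2| ^ a) * (|z.1| ^ b - |z.2| ^ b)) =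
      fun z => (|z.1| ^ (a + b) - |z.1| ^ a * |z.2| ^ b) +
        (|z.2| ^ (a + b) - |z.1| ^ b * |z.2| ^ a) := by
    ext z; ring
  have i1 : Integrable (fun z : ℝ × ℝ => |z.1| ^ (a + b)) (ν.prod ν) := h.comp_fst ν
  have i2 : Integrable (fun z : ℝ × ℝ => |z.2| ^ (a + b)) (ν.prod ν) := h.comp_snd ν
  have i3 : Integrable (fun z : ℝ × ℝ => |z.1| ^ a * |z.2| ^ b) (ν.prod ν) := ha.mul_prod hb
  have i4 : Integrable (fun z : ℝ × ℝ => |z.1| ^ b * |z.2| ^ a) (ν.prod ν) := hb.mul_prod ha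
  have i13 : Integrable (fun z : ℝ × ℝ => |z.1| ^ (a + b) - |z.1| ^ a * |z.2| ^ b) (ν.prod ν) :=
    i1.sub i3
  have i24 : Integrable (fun z : ℝ × ℝ => |z.2| ^ (a + b) - |z.1| ^ b * |z.2| ^ a) (ν.prod ν) :=
    i2.sub i4
  rw [e, integral_add i13 i24, integral_sub i1 i3, integral_sub i2 i4,
    integral_fun_fst (fun x : ℝ => |x| ^ (a + b)), integral_fun_snd (fun x : ℝ => |x| ^ (a + b)),
    integral_prod_mul (fun x : ℝ => |x| ^ a) (fun x : ℝ => |x| ^ b),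
    integral_prod_mul (fun x : ℝ => |x| ^ b) (fun x : ℝ => |x| ^ a)] at key
  simp at key
  linarith

lemma integral_pow_succ_eq_sum_cumulant {Ω : Type*} [MeasureSpace Ω]
    [IsProbabilityMeasure (ℙ : Measure Ω)] {ζ : Ω → ℝ} (hζ : Measurable ζ) {r : ℕ}
    (hInt : Integrable (fun x : ℝ => |x| ^ (r + 1)) (Measure.map ζ ℙ)) :
    ((∫ x, x ^ (r + 1) ∂(Measure.map ζ ℙ) : ℝ) : ℂ) = ∑ j ∈ range (r + 1),
      (r.choose j : ℂ) * cumulant ζ (j + 1) * ((∫ x, x ^ (r - j) ∂(Measure.map ζ ℙ) : ℝ) : ℂ) := by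
  set ν := Measure.map ζ ℙ with hν
  have : IsProbabilityMeasure ν := Measure.isProbabilityMeasure_map hζ.aemeasurable
  have hmem : ∀ k ≤ r + 1, MemLp id (k : ENNReal) ν := by
    intro k hk
    have h1 : MemLp (id : ℝ → ℝ) ((r + 1 : ℕ) : ENNReal) ν := by
      rw [← integrable_norm_rpow_iff (by fun_prop) (by simp) (by simp)]
      simpa only [ENNReal.toReal_natCast, Real.rpow_natCast] using! hInt
    exact h1.mono_exponent (by exact_mod_cast hk)
  have hφ : (fun t : ℝ => Complex.log (∫ ω, Complex.exp (Complex.I * t * ζ ω))) =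
      fun t => Complex.log (charFun ν t) := by
    ext t
    rw [charFun_apply_real, hν, integral_map hζ.aemeasurable (by fun_prop)]
    congr 2
    ext ω
    ring_nf
  set L : ℝ → ℂ := fun t => Complex.log (charFun ν t)
  have hcd : ContDiff ℝ (r + 1 : ℕ) (charFun ν) := contDiff_charFun (hmem (r + 1) le_rfl)
  have h0 : charFun ν 0 = 1 := by simp
  have hslit : ∀ᶠ t in nhds (0 : ℝ), charFun ν t ∈ slitPlane :=
    hcd.continuous.continuousAt.eventually_mem (isOpen_slitPlane.mem_nhds (by simp [h0]))
  have hdiff : Differentiable ℝ (charFun ν) := hcd.differentiable (by simp)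
  have hderiv : deriv L =ᶠ[nhds 0] fun t => deriv (charFun ν) t / charFun ν t := by
    filter_upwards [hslit] with t ht
    exact ((hdiff t).hasDerivAt.clog_real ht).deriv
  have heq : deriv (charFun ν) =ᶠ[nhds 0] deriv L * charFun ν := by
    filter_upwards [hslit, hderiv] with t ht hdt
    rw [Pi.mul_apply, hdt, div_mul_cancel₀ _ (slitPlane_ne_zero ht)]
  have hLd : ContDiffAt ℝ r (deriv L) 0 := by
    have h1 : ContDiff ℝ r (deriv (charFun ν)) :=
      (contDiff_succ_iff_deriv.1 (by exact_mod_cast hcd)).2.2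
    have h2 : ContDiff ℝ r (charFun ν) := hcd.of_le (by exact_mod_cast Nat.le_succ r)
    refine ContDiffAt.congr_of_eventuallyEq ?_ hderiv
    simp only [div_eq_mul_inv]
    exact h1.contDiffAt.mul (h2.contDiffAt.inv (by simp [h0]))
  have hmain : iteratedDeriv (r + 1) (charFun ν) 0 = ∑ j ∈ range (r + 1),
      (r.choose j : ℂ) * iteratedDeriv (j + 1) L 0 * iteratedDeriv (r - j) (charFun ν) 0 := by
    rw [iteratedDeriv_succ', heq.iteratedDeriv_eq r, iteratedDeriv_mul hLd
      (hcd.contDiffAt.of_le (by exact_mod_cast Nat.le_succ r))]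
    simp only [iteratedDeriv_succ']
  rw [iteratedDeriv_charFun_zero (hmem _ le_rfl)] at hmain
  have hI : (I : ℂ) ^ (r + 1) ≠ 0 := pow_ne_zero _ I_ne_zero
  rw [← mul_right_inj' hI, hmain, mul_sum]
  refine sum_congr rfl fun j hj => ?_
  have hj' : j ≤ r := by simpa [Nat.lt_succ_iff] using hj
  rw [iteratedDeriv_charFun_zero (hmem _ (by omega)), cumulant, hφ]
  have e : r + 1 = (j + 1) + (r - j) := by omega
  have hIj : (I : ℂ) ^ (j + 1) ≠ 0 := pow_ne_zero _ I_ne_zero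
  rw [e, pow_add]
  field_simp

lemma one_add_sum_choose_mul_pow_le (r : ℕ) :
    1 + ∑ j ∈ range r, r.choose j * (j + 1) ^ (j + 1) ≤ (r + 1) ^ (r + 1) := by
  rcases Nat.eq_zero_or_pos r with rfl | hr
  · simp
  have h1 : ∑ j ∈ range r, r.choose j * (j + 1) ^ (j + 1) ≤
      ∑ j ∈ range r, r * (r ^ j * 1 ^ (r - j) * r.choose j) := by
    refine sum_le_sum fun j hj => ?_
    have : (j + 1) ^ (j + 1) ≤ r ^ (j + 1) := Nat.pow_le_pow_left (mem_range.1 hj) _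
    calc r.choose j * (j + 1) ^ (j + 1) ≤ r.choose j * r ^ (j + 1) := Nat.mul_le_mul_left _ this
      _ = _ := by ring
  have h2 := add_pow r 1 r
  rw [sum_range_succ] at h2
  rw [← mul_sum] at h1
  have h3 : 1 ≤ r ^ r := Nat.one_le_pow _ _ hr
  have h4 : r * (r + 1) ^ r =
      r * (∑ j ∈ range r, r ^ j * 1 ^ (r - j) * r.choose j) + r * r ^ r := by
    rw [h2]; simp; ring
  have h5 : (r + 1) ^ (r + 1) = r * (r + 1) ^ r + (r + 1) ^ r := by ring
  nlinarith [Nat.zero_le ((r + 1) ^ r)]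

lemma norm_integral_pow_le (ν : Measure ℝ) (k : ℕ) :
    ‖((∫ x, x ^ k ∂ν : ℝ) : ℂ)‖ ≤ ∫ x, |x| ^ k ∂ν := by
  rw [norm_real]
  refine (norm_integral_le_integral_norm _).trans (le_of_eq ?_)
  simp

/-- Numbers `κ` satisfying the moment–cumulant recursion of `ν` grow at most like `n ^ n` times the
absolute moments. -/
lemma norm_le_of_moment_recursion {ν : Measure ℝ} [IsProbabilityMeasure ν] {N : ℕ} {κ : ℕ → ℂ}
    (hInt : Integrable (fun x : ℝ => |x| ^ N) ν)
    (hrec : ∀ r < N, ((∫ x, x ^ (r + 1) ∂ν : ℝ) : ℂ) = ∑ j ∈ range (r + 1),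
      (r.choose j : ℂ) * κ (j + 1) * ((∫ x, x ^ (r - j) ∂ν : ℝ) : ℂ)) :
    ∀ r < N, ‖κ (r + 1)‖ ≤ ((r + 1) ^ (r + 1) : ℕ) * ∫ x, |x| ^ (r + 1) ∂ν := by
  intro r
  induction r using Nat.strong_induction_on with
  | _ r ih =>
    intro hr
    have h := hrec r hr
    rw [sum_range_succ] at h
    have hκ : κ (r + 1) = ((∫ x, x ^ (r + 1) ∂ν : ℝ) : ℂ) - ∑ j ∈ range r,
        (r.choose j : ℂ) * κ (j + 1) * ((∫ x, x ^ (r - j) ∂ν : ℝ) : ℂ) := by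
      rw [h]; simp
    have hnn : 0 ≤ ∫ x, |x| ^ (r + 1) ∂ν := integral_nonneg fun x => by positivity
    calc ‖κ (r + 1)‖ ≤ ∫ x, |x| ^ (r + 1) ∂ν + ∑ j ∈ range r,
          ((r.choose j * (j + 1) ^ (j + 1) : ℕ) : ℝ) * ∫ x, |x| ^ (r + 1) ∂ν := by
          rw [hκ]
          refine (norm_sub_le _ _).trans (add_le_add (norm_integral_pow_le ν _)
            ((norm_sum_le _ _).trans (sum_le_sum fun j hj => ?_)))
          have hj' : j < r := mem_range.1 hj
          have hmul : (∫ x, |x| ^ (j + 1) ∂ν) * (∫ x, |x| ^ (r - j) ∂ν) ≤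
              ∫ x, |x| ^ (r + 1) ∂ν := by
            have e : j + 1 + (r - j) = r + 1 := by omega
            rw [← e]
            exact integral_pow_abs_mul_le (integrable_pow_abs_of_le (by omega) hInt)
          rw [norm_mul, norm_mul, norm_natCast, Nat.cast_mul, mul_assoc, mul_assoc]
          refine mul_le_mul_of_nonneg_left ?_ (Nat.cast_nonneg _)
          calc ‖κ (j + 1)‖ * ‖((∫ x, x ^ (r - j) ∂ν : ℝ) : ℂ)‖
              ≤ (((j + 1) ^ (j + 1) : ℕ) * ∫ x, |x| ^ (j + 1) ∂ν) * ∫ x, |x| ^ (r - j) ∂ν :=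
                mul_le_mul (ih j hj' (by omega)) (norm_integral_pow_le ν _) (norm_nonneg _)
                  (mul_nonneg (Nat.cast_nonneg _) (integral_nonneg fun x => by positivity))
            _ ≤ _ := by
                rw [mul_assoc]
                exact mul_le_mul_of_nonneg_left hmul (Nat.cast_nonneg _)
      _ = ((1 + ∑ j ∈ range r, r.choose j * (j + 1) ^ (j + 1) : ℕ) : ℝ) *
            ∫ x, |x| ^ (r + 1) ∂ν := by
          rw [← sum_mul]; push_cast; ring
      _ ≤ _ := mul_le_mul_of_nonneg_right
          (Nat.cast_le.2 (one_add_sum_choose_mul_pow_le r)) hnn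

lemma integral_mul_sum_eq_of_moment_recursion {n : ℕ} {m κ a : ℕ → ℂ}
    (hrec : ∀ r < n, m (r + 1) = ∑ j ∈ range (r + 1), (r.choose j : ℂ) * κ (j + 1) * m (r - j)) :
    ∑ r ∈ range n, a r / (r.factorial : ℂ) * m (r + 1) =
      ∑ j ∈ range n, κ (j + 1) / (j.factorial : ℂ) *
        ∑ k ∈ range (n - j), a (j + k) / (k.factorial : ℂ) * m k := by
  have h := sum_range_diag_flip n fun j k =>
    κ (j + 1) / (j.factorial : ℂ) * (a (j + k) / (k.factorial : ℂ) * m k)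
  simp only [mul_sum]
  rw [← h]
  refine sum_congr rfl fun r hr => ?_
  rw [hrec r (mem_range.1 hr), mul_sum]
  refine sum_congr rfl fun j hj => ?_
  have hj' : j ≤ r := Nat.lt_succ_iff.1 (mem_range.1 hj)
  rw [Nat.add_sub_cancel' hj', Nat.cast_choose ℂ hj']
  have h1 : (r.factorial : ℂ) ≠ 0 := by exact_mod_cast r.factorial_ne_zero
  have h2 : (j.factorial : ℂ) ≠ 0 := by exact_mod_cast j.factorial_ne_zero
  have h3 : ((r - j).factorial : ℂ) ≠ 0 := by exact_mod_cast (r - j).factorial_ne_zero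
  field_simp

/-- Cumulant expansion of `E{ζ f(ζ)}`, where `f 0, f 1, …` are the successive derivatives of the
function `f 0`. -/
lemma norm_integral_mul_sub_sum_le {ν : Measure ℝ} [IsProbabilityMeasure ν] {n : ℕ} {κ : ℕ → ℂ}
    (hInt : Integrable (fun x : ℝ => |x| ^ (n + 1)) ν)
    (hrec : ∀ r < n, ((∫ x, x ^ (r + 1) ∂ν : ℝ) : ℂ) = ∑ j ∈ range (r + 1),
      (r.choose j : ℂ) * κ (j + 1) * ((∫ x, x ^ (r - j) ∂ν : ℝ) : ℂ))
    {f : ℕ → ℝ → ℂ} {M : ℝ} (hd : ∀ j < n, ∀ x, HasDerivAt (f j) (f (j + 1) x) x)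
    (hM : ∀ x, ‖f n x‖ ≤ M) (hn : 0 < n) :
    ‖(∫ x, (x : ℂ) * f 0 x ∂ν) - ∑ j ∈ range n, κ (j + 1) / (j.factorial : ℂ) * ∫ x, f j x ∂ν‖
      ≤ ((n + 1) ^ (n + 1) : ℕ) / (n.factorial : ℝ) * (∫ x, |x| ^ (n + 1) ∂ν) * M := by
  have hM0 : 0 ≤ M := (norm_nonneg _).trans (hM 0)
  have hmeas : ∀ j < n, Continuous (f j) := fun j hj =>
    continuous_iff_continuousAt.2 fun x => (hd j hj x).continuousAt
  have hpow : ∀ k ≤ n + 1, Integrable (fun x : ℝ => (x : ℂ) ^ k) ν := fun k hk => by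
    refine (integrable_pow_abs_of_le hk hInt).mono' (by fun_prop) (ae_of_all _ fun x => ?_)
    simp
  set T : ℕ → ℝ → ℂ := fun j x =>
    ∑ k ∈ range (n - j), f (j + k) 0 / (k.factorial : ℂ) * (x : ℂ) ^ k with hT
  have hTc : ∀ j, Continuous (T j) := fun j => by fun_prop
  have hR : ∀ j < n, ∀ x, ‖f j x - T j x‖ ≤ M * |x| ^ (n - j) / (n - j).factorial := by
    intro j hj x
    have h := norm_sub_taylor_le (n := n - j) (fun i => f (j + i)) (M := M)
      (fun i hi => hd (j + i) (by omega)) (by simpa [Nat.add_sub_cancel' hj.le] using hM) x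
    have e : T j x = ∑ k ∈ range (n - j), f (j + k) 0 * (x : ℂ) ^ k / (k.factorial : ℂ) :=
      sum_congr rfl fun k _ => by ring
    rw [e]
    exact h
  have hTint : ∀ j, Integrable (T j) ν := fun j =>
    integrable_finsetSum _ fun k hk =>
      (hpow k (by have := mem_range.1 hk; omega)).const_mul _
  have hRint : ∀ j < n, Integrable (fun x => f j x - T j x) ν := fun j hj =>
    (((integrable_pow_abs_of_le (by omega) hInt).const_mul M).div_const _).mono'
      ((hmeas j hj).sub (hTc j)).aestronglyMeasurable (ae_of_all _ (hR j hj))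
  have hxT : (fun x : ℝ => (x : ℂ) * T 0 x) = fun x : ℝ => ∑ k ∈ range n,
      f k 0 / (k.factorial : ℂ) * (x : ℂ) ^ (k + 1) := by
    ext x
    simp only [hT, mul_sum, Nat.sub_zero, zero_add]
    refine sum_congr rfl fun k _ => ?_
    ring
  have hxTint : Integrable (fun x : ℝ => (x : ℂ) * T 0 x) ν := by
    rw [hxT]
    exact integrable_finsetSum _ fun k hk =>
      (hpow (k + 1) (by have := mem_range.1 hk; omega)).const_mul _
  have hxR : ∀ x : ℝ, ‖(x : ℂ) * (f 0 x - T 0 x)‖ ≤ M * |x| ^ (n + 1) / n.factorial := by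
    intro x
    rw [norm_mul, norm_real, Real.norm_eq_abs]
    calc |x| * ‖f 0 x - T 0 x‖ ≤ |x| * (M * |x| ^ (n - 0) / (n - 0).factorial) :=
          mul_le_mul_of_nonneg_left (hR 0 hn x) (abs_nonneg x)
      _ = _ := by rw [Nat.sub_zero]; ring
  have hxRint : Integrable (fun x : ℝ => (x : ℂ) * (f 0 x - T 0 x)) ν :=
    ((hInt.const_mul M).div_const _).mono'
      (continuous_ofReal.mul ((hmeas 0 hn).sub (hTc 0))).aestronglyMeasurable (ae_of_all _ hxR)
  have hmain : (∫ x, (x : ℂ) * T 0 x ∂ν) =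
      ∑ j ∈ range n, κ (j + 1) / (j.factorial : ℂ) * ∫ x, T j x ∂ν := by
    have h := integral_mul_sum_eq_of_moment_recursion (n := n) (κ := κ) (a := fun k => f k 0)
      (m := fun k => ((∫ x, x ^ k ∂ν : ℝ) : ℂ)) hrec
    have hm : ∀ k, ∫ x : ℝ, (x : ℂ) ^ k ∂ν = ((∫ x, x ^ k ∂ν : ℝ) : ℂ) := fun k => by
      simp only [← ofReal_pow]; exact integral_ofReal
    rw [hxT, integral_finsetSum _ fun k hk =>
      (hpow (k + 1) (by have := mem_range.1 hk; omega)).const_mul _]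
    simp only [integral_const_mul, hm]
    rw [h]
    refine sum_congr rfl fun j _ => ?_
    rw [integral_finsetSum _ fun k hk =>
      (hpow k (by have := mem_range.1 hk; omega)).const_mul _]
    simp only [integral_const_mul, hm]
  have hsplit : (∫ x, (x : ℂ) * f 0 x ∂ν) -
        ∑ j ∈ range n, κ (j + 1) / (j.factorial : ℂ) * ∫ x, f j x ∂ν =
      (∫ x, (x : ℂ) * (f 0 x - T 0 x) ∂ν) -
        ∑ j ∈ range n, κ (j + 1) / (j.factorial : ℂ) * ∫ x, (f j x - T j x) ∂ν := by
    have h1 : ∫ x, (x : ℂ) * f 0 x ∂ν =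
        (∫ x, (x : ℂ) * (f 0 x - T 0 x) ∂ν) + ∫ x, (x : ℂ) * T 0 x ∂ν := by
      rw [← integral_add hxRint hxTint]
      refine integral_congr_ae (ae_of_all _ fun x => ?_)
      ring
    have h2 : ∀ j ∈ range n, κ (j + 1) / (j.factorial : ℂ) * ∫ x, f j x ∂ν =
        κ (j + 1) / (j.factorial : ℂ) * (∫ x, (f j x - T j x) ∂ν) +
          κ (j + 1) / (j.factorial : ℂ) * ∫ x, T j x ∂ν := by
      intro j hj
      rw [← mul_add, ← integral_add (hRint j (mem_range.1 hj)) (hTint j)]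
      simp
    rw [h1, hmain, sum_congr rfl h2, sum_add_distrib]
    ring
  set m := ∫ x, |x| ^ (n + 1) ∂ν with hm
  have hm0 : 0 ≤ m := integral_nonneg fun x => by positivity
  have hb1 : ‖∫ x, (x : ℂ) * (f 0 x - T 0 x) ∂ν‖ ≤ M * m / n.factorial := by
    refine (norm_integral_le_of_norm_le ((hInt.const_mul M).div_const _)
      (ae_of_all _ hxR)).trans (le_of_eq ?_)
    rw [integral_div, integral_const_mul]
  have hb2 : ∀ j ∈ range n,
      ‖κ (j + 1) / (j.factorial : ℂ) * ∫ x, (f j x - T j x) ∂ν‖ ≤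
        ((n.choose j * (j + 1) ^ (j + 1) : ℕ) : ℝ) * (M * m / n.factorial) := by
    intro j hj
    have hj' := mem_range.1 hj
    have hrem : ‖∫ x, (f j x - T j x) ∂ν‖ ≤
        M * (∫ x, |x| ^ (n - j) ∂ν) / (n - j).factorial := by
      refine (norm_integral_le_of_norm_le
        (((integrable_pow_abs_of_le (by omega) hInt).const_mul M).div_const _)
        (ae_of_all _ (hR j hj'))).trans (le_of_eq ?_)
      rw [integral_div, integral_const_mul]
    have hκ := norm_le_of_moment_recursion (integrable_pow_abs_of_le (by omega) hInt) hrec j hj'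
    have hmul : (∫ x, |x| ^ (j + 1) ∂ν) * (∫ x, |x| ^ (n - j) ∂ν) ≤ m := by
      have e : j + 1 + (n - j) = n + 1 := by omega
      rw [hm, ← e]
      exact integral_pow_abs_mul_le (by rwa [e])
    rw [norm_mul, norm_div, Complex.norm_natCast]
    have h2 : (0 : ℝ) < j.factorial := by exact_mod_cast j.factorial_pos
    have h3 : (0 : ℝ) < (n - j).factorial := by exact_mod_cast (n - j).factorial_pos
    have h4 : (0 : ℝ) < n.factorial := by exact_mod_cast n.factorial_pos
    calc ‖κ (j + 1)‖ / j.factorial * ‖∫ x, (f j x - T j x) ∂ν‖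
        ≤ (((j + 1) ^ (j + 1) : ℕ) * ∫ x, |x| ^ (j + 1) ∂ν) / j.factorial *
            (M * (∫ x, |x| ^ (n - j) ∂ν) / (n - j).factorial) := by
          refine mul_le_mul (div_le_div_of_nonneg_right hκ h2.le) hrem (norm_nonneg _) ?_
          exact div_nonneg (mul_nonneg (Nat.cast_nonneg _)
            (integral_nonneg fun x => by positivity)) h2.le
      _ = (((j + 1) ^ (j + 1) : ℕ) * M / (j.factorial * (n - j).factorial)) *
            ((∫ x, |x| ^ (j + 1) ∂ν) * ∫ x, |x| ^ (n - j) ∂ν) := by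
          field_simp
      _ ≤ (((j + 1) ^ (j + 1) : ℕ) * M / (j.factorial * (n - j).factorial)) * m :=
          mul_le_mul_of_nonneg_left hmul (by positivity)
      _ = _ := by
          rw [Nat.cast_mul, Nat.cast_choose ℝ hj'.le]
          field_simp
  rw [hsplit]
  calc _ ≤ M * m / n.factorial + ∑ j ∈ range n,
        ((n.choose j * (j + 1) ^ (j + 1) : ℕ) : ℝ) * (M * m / n.factorial) :=
        (norm_sub_le _ _).trans (add_le_add hb1
          ((norm_sum_le _ _).trans (sum_le_sum hb2)))
    _ = ((1 + ∑ j ∈ range n, n.choose j * (j + 1) ^ (j + 1) : ℕ) : ℝ) *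
          (M * m / n.factorial) := by
        rw [← sum_mul]; push_cast; ring
    _ ≤ (((n + 1) ^ (n + 1) : ℕ) : ℝ) * (M * m / n.factorial) :=
        mul_le_mul_of_nonneg_right (Nat.cast_le.2 (one_add_sum_choose_mul_pow_le n))
          (by positivity)
    _ = _ := by ring

/-- Differentiation of `θ ↦ E{g(sin θ ζ + cos θ ζ')}`. -/
lemma hasDerivAt_integral_sin_cos {P : Measure (ℝ × ℝ)} [IsProbabilityMeasure P]
    (h1 : Integrable (fun z : ℝ × ℝ => z.1) P) (h2 : Integrable (fun z : ℝ × ℝ => z.2) P)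
    {g g' : ℝ → ℂ} (hg : ∀ x, HasDerivAt g (g' x) x) (hg' : Continuous g') {B : ℝ}
    (hB : ∀ x, ‖g' x‖ ≤ B) (θ : ℝ) :
    HasDerivAt (fun θ => ∫ z, g (Real.sin θ * z.1 + Real.cos θ * z.2) ∂P)
      (∫ z, ((Real.cos θ * z.1 - Real.sin θ * z.2 : ℝ) : ℂ) *
        g' (Real.sin θ * z.1 + Real.cos θ * z.2) ∂P) θ := by
  have hgc : Continuous g := continuous_iff_continuousAt.2 fun x => (hg x).continuousAt
  have hB0 : 0 ≤ B := (norm_nonneg _).trans (hB 0)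
  have hlip : ∀ x, ‖g x‖ ≤ ‖g 0‖ + B * |x| := fun x => by
    have h := Convex.norm_image_sub_le_of_norm_hasDerivWithin_le (𝕜 := ℝ) (f := g) (f' := g')
      (s := Set.univ)
      (fun y _ => (hg y).hasDerivWithinAt) (fun y _ => hB y) convex_univ
      (Set.mem_univ 0) (Set.mem_univ x)
    rw [sub_zero, Real.norm_eq_abs] at h
    have := norm_le_norm_add_norm_sub' (g x) (g 0)
    linarith
  have habs : ∀ θ : ℝ, ∀ z : ℝ × ℝ, |Real.sin θ * z.1 + Real.cos θ * z.2| ≤ |z.1| + |z.2| := by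
    intro θ z
    refine (abs_add_le _ _).trans (add_le_add ?_ ?_) <;> rw [abs_mul]
    · exact mul_le_of_le_one_left (abs_nonneg _) (Real.abs_sin_le_one θ)
    · exact mul_le_of_le_one_left (abs_nonneg _) (Real.abs_cos_le_one θ)
  have habs' : ∀ θ : ℝ, ∀ z : ℝ × ℝ, |Real.cos θ * z.1 - Real.sin θ * z.2| ≤ |z.1| + |z.2| := by
    intro θ z
    refine (abs_sub _ _).trans (add_le_add ?_ ?_) <;> rw [abs_mul]
    · exact mul_le_of_le_one_left (abs_nonneg _) (Real.abs_cos_le_one θ)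
    · exact mul_le_of_le_one_left (abs_nonneg _) (Real.abs_sin_le_one θ)
  have hInt : Integrable (fun z : ℝ × ℝ => |z.1| + |z.2|) P := h1.abs.add h2.abs
  refine (hasDerivAt_integral_of_dominated_loc_of_deriv_le (𝕜 := ℝ) (s := Set.univ)
    (F := fun θ z => g (Real.sin θ * z.1 + Real.cos θ * z.2))
    (F' := fun θ z => ((Real.cos θ * z.1 - Real.sin θ * z.2 : ℝ) : ℂ) *
      g' (Real.sin θ * z.1 + Real.cos θ * z.2))
    (bound := fun z : ℝ × ℝ => (|z.1| + |z.2|) * B) Filter.univ_mem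
    (Filter.Eventually.of_forall fun θ => ?_) ?_ ?_ (ae_of_all _ fun z θ _ => ?_)
    (hInt.mul_const B) (ae_of_all _ fun z θ _ => ?_)).2
  · exact Continuous.aestronglyMeasurable (by fun_prop)
  · refine ((integrable_const ‖g 0‖).add (hInt.const_mul B)).mono'
      (Continuous.aestronglyMeasurable (by fun_prop)) (ae_of_all _ fun z => ?_)
    exact (hlip _).trans (add_le_add le_rfl (mul_le_mul_of_nonneg_left (habs θ z) hB0))
  · exact Continuous.aestronglyMeasurable (by fun_prop)
  · rw [norm_mul, norm_real, Real.norm_eq_abs]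
    exact mul_le_mul (habs' θ z) (hB _) (norm_nonneg _) (by positivity)
  · have h := ((Real.hasDerivAt_sin θ).mul_const z.1).add ((Real.hasDerivAt_cos θ).mul_const z.2)
    have h3 := (hg (Real.sin θ * z.1 + Real.cos θ * z.2)).scomp θ h
    convert! h3 using 1
    rw [real_smul]
    congr 2
    ring

lemma continuous_integral_sin_cos {P : Measure (ℝ × ℝ)} [IsProbabilityMeasure P]
    (h1 : Integrable (fun z : ℝ × ℝ => z.1) P) (h2 : Integrable (fun z : ℝ × ℝ => z.2) P)
    {g' : ℝ → ℂ} (hg' : Continuous g') {B : ℝ} (hB : ∀ x, ‖g' x‖ ≤ B) :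
    Continuous fun θ : ℝ => ∫ z, ((Real.cos θ * z.1 - Real.sin θ * z.2 : ℝ) : ℂ) *
        g' (Real.sin θ * z.1 + Real.cos θ * z.2) ∂P := by
  refine continuous_of_dominated (bound := fun z : ℝ × ℝ => (|z.1| + |z.2|) * B)
    (fun θ => Continuous.aestronglyMeasurable (by fun_prop)) (fun θ => ae_of_all _ fun z => ?_)
    ((h1.abs.add h2.abs).mul_const B) (ae_of_all _ fun z => by fun_prop)
  rw [norm_mul, norm_real, Real.norm_eq_abs]
  refine mul_le_mul ?_ (hB _) (norm_nonneg _) (by positivity)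
  refine (abs_sub _ _).trans (add_le_add ?_ ?_) <;> rw [abs_mul]
  · exact mul_le_of_le_one_left (abs_nonneg _) (Real.abs_cos_le_one θ)
  · exact mul_le_of_le_one_left (abs_nonneg _) (Real.abs_sin_le_one θ)

lemma integrable_comp_linear {P : Measure (ℝ × ℝ)} [IsProbabilityMeasure P] {g : ℝ → ℂ}
    (hg : Continuous g) {B : ℝ} (hB : ∀ x, ‖g x‖ ≤ B) (a b : ℝ) :
    Integrable (fun z : ℝ × ℝ => g (a * z.1 + b * z.2)) P :=
  (integrable_const B).mono' (Continuous.aestronglyMeasurable (by fun_prop))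
    (ae_of_all _ fun _ => hB _)

/-- The cumulant expansion applied conditionally on an independent variable. -/
lemma norm_integral_prod_fst_mul_sub_sum_le {ν γ : Measure ℝ} [IsProbabilityMeasure ν]
    [IsProbabilityMeasure γ] {n : ℕ} (hn : 0 < n) {κ : ℕ → ℂ}
    (hInt : Integrable (fun x : ℝ => |x| ^ (n + 1)) ν)
    (hrec : ∀ r < n, ((∫ x, x ^ (r + 1) ∂ν : ℝ) : ℂ) = ∑ j ∈ range (r + 1),
      (r.choose j : ℂ) * κ (j + 1) * ((∫ x, x ^ (r - j) ∂ν : ℝ) : ℂ))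
    {φ : ℕ → ℝ → ℂ} {M : ℝ} (hd : ∀ j < n, ∀ x, HasDerivAt (φ j) (φ (j + 1) x) x)
    (hbdd : ∀ j < n, ∃ B : ℝ, ∀ x, ‖φ j x‖ ≤ B)
    (hM : ∀ x, ‖φ n x‖ ≤ M) {a : ℝ} (ha : |a| ≤ 1) (b : ℝ) :
    ‖(∫ z, (z.1 : ℂ) * φ 0 (a * z.1 + b * z.2) ∂(ν.prod γ)) -
        ∑ j ∈ range n, κ (j + 1) / (j.factorial : ℂ) *
          ((a : ℂ) ^ j * ∫ z, φ j (a * z.1 + b * z.2) ∂(ν.prod γ))‖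
      ≤ ((n + 1) ^ (n + 1) : ℕ) / (n.factorial : ℝ) * (∫ x, |x| ^ (n + 1) ∂ν) * M := by
  have hM0 : 0 ≤ M := (norm_nonneg _).trans (hM 0)
  have hcont : ∀ j < n, Continuous (φ j) := fun j hj =>
    continuous_iff_continuousAt.2 fun x => (hd j hj x).continuousAt
  have hi : ∀ j < n, Integrable (fun z : ℝ × ℝ => φ j (a * z.1 + b * z.2)) (ν.prod γ) :=
    fun j hj => by
      obtain ⟨B, hB⟩ := hbdd j hj
      exact integrable_comp_linear (hcont j hj) hB a b
  have hx : Integrable (fun x : ℝ => (x : ℂ)) ν := by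
    refine Integrable.ofReal ?_
    have := integrable_pow_abs_of_le (k := 1) (by omega) hInt
    exact (integrable_norm_iff (by fun_prop)).1 (by simpa using this)
  have hi0 : Integrable (fun z : ℝ × ℝ => (z.1 : ℂ) * φ 0 (a * z.1 + b * z.2)) (ν.prod γ) := by
    obtain ⟨B, hB⟩ := hbdd 0 hn
    have := hcont 0 hn
    exact (hx.comp_fst γ).mul_bdd (Continuous.aestronglyMeasurable (by fun_prop))
      (ae_of_all _ fun _ => hB _)
  have key : ∀ y, ‖(∫ x, (x : ℂ) * φ 0 (a * x + b * y) ∂ν) -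
      ∑ j ∈ range n, κ (j + 1) / (j.factorial : ℂ) * ((a : ℂ) ^ j * ∫ x, φ j (a * x + b * y) ∂ν)‖
      ≤ ((n + 1) ^ (n + 1) : ℕ) / (n.factorial : ℝ) * (∫ x, |x| ^ (n + 1) ∂ν) * M := by
    intro y
    have h := norm_integral_mul_sub_sum_le hInt hrec
      (f := fun j x => (a : ℂ) ^ j * φ j (a * x + b * y)) (M := M) ?_ ?_ hn
    · simpa [integral_const_mul] using h
    · intro j hj x
      have h1 : HasDerivAt (fun x : ℝ => a * x + b * y) a x := by
        simpa using ((hasDerivAt_id x).const_mul a).add_const (b * y)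
      have h2 := ((hd j hj (a * x + b * y)).scomp x h1).const_mul ((a : ℂ) ^ j)
      convert! h2 using 1
      rw [real_smul]
      ring
    · intro x
      rw [norm_mul, norm_pow, norm_real, Real.norm_eq_abs]
      exact (mul_le_of_le_one_left (norm_nonneg _) (pow_le_one₀ (abs_nonneg a) ha)).trans (hM _)
  have hterm : ∀ j ∈ range n, κ (j + 1) / (j.factorial : ℂ) *
      ((a : ℂ) ^ j * ∫ z, φ j (a * z.1 + b * z.2) ∂(ν.prod γ)) =
      ∫ y, κ (j + 1) / (j.factorial : ℂ) * ((a : ℂ) ^ j * ∫ x, φ j (a * x + b * y) ∂ν) ∂γ := by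
    intro j hj
    rw [integral_prod_symm _ (hi j (mem_range.1 hj)), integral_const_mul, integral_const_mul]
  have hii : ∀ j ∈ range n, Integrable (fun y => κ (j + 1) / (j.factorial : ℂ) *
      ((a : ℂ) ^ j * ∫ x, φ j (a * x + b * y) ∂ν)) γ := fun j hj =>
    ((hi j (mem_range.1 hj)).integral_prod_right.const_mul _).const_mul _
  rw [sum_congr rfl hterm, ← integral_finsetSum _ hii, integral_prod_symm _ hi0,
    ← integral_sub hi0.integral_prod_right (integrable_finsetSum _ hii)]
  refine (norm_integral_le_of_norm_le_const (ae_of_all _ key)).trans ?_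
  simp

lemma integral_prod_snd_mul_gaussianReal {ν : Measure ℝ} [IsProbabilityMeasure ν] {v : NNReal}
    {g g' : ℝ → ℂ} (hg : ∀ x, HasDerivAt g (g' x) x) (hg' : Continuous g') {B B' : ℝ}
    (hB : ∀ x, ‖g x‖ ≤ B) (hB' : ∀ x, ‖g' x‖ ≤ B') (a b : ℝ) :
    ∫ z, (z.2 : ℂ) * g (a * z.1 + b * z.2) ∂(ν.prod (gaussianReal 0 v)) =
      v * (b * ∫ z, g' (a * z.1 + b * z.2) ∂(ν.prod (gaussianReal 0 v))) := by
  have hgc : Continuous g := continuous_iff_continuousAt.2 fun x => (hg x).continuousAt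
  have hx : Integrable (fun x : ℝ => (x : ℂ)) (gaussianReal 0 v) :=
    ((memLp_id_gaussianReal 1).integrable (by simp)).ofReal
  have hi : Integrable (fun z : ℝ × ℝ => (z.2 : ℂ) * g (a * z.1 + b * z.2))
      (ν.prod (gaussianReal 0 v)) :=
    (hx.comp_snd ν).mul_bdd (Continuous.aestronglyMeasurable (by fun_prop))
      (ae_of_all _ fun _ => hB _)
  have hi' := integrable_comp_linear (P := ν.prod (gaussianReal 0 v)) hg' hB' a b
  rw [integral_prod _ hi, integral_prod _ hi', ← integral_const_mul, ← integral_const_mul]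
  refine integral_congr_ae (ae_of_all _ fun x => ?_)
  have h := integral_mul_gaussianReal_zero (v := v) (g := fun y => g (a * x + b * y))
    (g' := fun y => (b : ℂ) * g' (a * x + b * y)) ?_ ?_ ?_ ?_
  · simpa [integral_const_mul] using h
  · intro y
    have h1 : HasDerivAt (fun y : ℝ => a * x + b * y) b y := by
      simpa using ((hasDerivAt_id y).const_mul b).const_add (a * x)
    exact (hg (a * x + b * y)).scomp y h1
  · exact (integrable_const B).mono' (Continuous.aestronglyMeasurable (by fun_prop))
      (ae_of_all _ fun _ => hB _)
  · exact hx.mul_bdd (Continuous.aestronglyMeasurable (by fun_prop))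
      (ae_of_all _ fun _ => hB _)
  · exact ((integrable_const B').mono' (Continuous.aestronglyMeasurable (by fun_prop))
      (ae_of_all _ fun _ => hB' _)).const_mul _

lemma norm_integral_rotation_sub_sum_le {ν : Measure ℝ} [IsProbabilityMeasure ν] {v : NNReal}
    {p : ℕ} (hp : 1 ≤ p) {κ : ℕ → ℂ} (hInt : Integrable (fun x : ℝ => |x| ^ (p + 2)) ν)
    (hrec : ∀ r < p + 1, ((∫ x, x ^ (r + 1) ∂ν : ℝ) : ℂ) = ∑ j ∈ range (r + 1),
      (r.choose j : ℂ) * κ (j + 1) * ((∫ x, x ^ (r - j) ∂ν : ℝ) : ℂ))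
    (hcen : ∫ x, x ∂ν = 0) (hvar : ∫ x, x ^ 2 ∂ν = v)
    {φ : ℕ → ℝ → ℂ} {M : ℝ} (hd : ∀ j < p + 1, ∀ x, HasDerivAt (φ j) (φ (j + 1) x) x)
    (hbdd : ∀ j < p + 1, ∃ B : ℝ, ∀ x, ‖φ j x‖ ≤ B) (hM : ∀ x, ‖φ (p + 1) x‖ ≤ M) (θ : ℝ) :
    ‖(∫ z, ((Real.cos θ * z.1 - Real.sin θ * z.2 : ℝ) : ℂ) *
          φ 0 (Real.sin θ * z.1 + Real.cos θ * z.2) ∂(ν.prod (gaussianReal 0 v))) -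
        ∑ l ∈ Icc 2 p, κ (l + 1) / (l.factorial : ℂ) * (Real.cos θ * (Real.sin θ : ℂ) ^ l *
          ∫ z, φ l (Real.sin θ * z.1 + Real.cos θ * z.2) ∂(ν.prod (gaussianReal 0 v)))‖
      ≤ |Real.cos θ| * (((p + 2) ^ (p + 2) : ℕ) / ((p + 1).factorial : ℝ) *
          (∫ x, |x| ^ (p + 2) ∂ν) * M) := by
  set P := ν.prod (gaussianReal 0 v) with hP
  have hcont : ∀ j < p + 1, Continuous (φ j) := fun j hj =>
    continuous_iff_continuousAt.2 fun x => (hd j hj x).continuousAt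
  have hc0 := hcont 0 (by omega)
  obtain ⟨B, hB⟩ := hbdd 0 (by omega)
  obtain ⟨B', hB'⟩ := hbdd 1 (by omega)
  have hx : Integrable (fun x : ℝ => (x : ℂ)) ν := by
    refine Integrable.ofReal ?_
    have := integrable_pow_abs_of_le (k := 1) (by omega) hInt
    exact (integrable_norm_iff (by fun_prop)).1 (by simpa using this)
  have hy : Integrable (fun x : ℝ => (x : ℂ)) (gaussianReal 0 v) :=
    ((memLp_id_gaussianReal 1).integrable (by simp)).ofReal
  have hi1 : Integrable (fun z : ℝ × ℝ =>
      (z.1 : ℂ) * φ 0 (Real.sin θ * z.1 + Real.cos θ * z.2)) P :=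
    (hx.comp_fst _).mul_bdd (Continuous.aestronglyMeasurable (by fun_prop))
      (ae_of_all _ fun _ => hB _)
  have hi2 : Integrable (fun z : ℝ × ℝ =>
      (z.2 : ℂ) * φ 0 (Real.sin θ * z.1 + Real.cos θ * z.2)) P :=
    (hy.comp_snd _).mul_bdd (Continuous.aestronglyMeasurable (by fun_prop))
      (ae_of_all _ fun _ => hB _)
  have hκ1 : κ 1 = 0 := by
    have h := hrec 0 (by omega)
    simpa [hcen] using h.symm
  have hκ2 : κ 2 = v := by
    have h := hrec 1 (by omega)
    simpa [sum_range_succ, hκ1, hvar] using h.symm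
  have hexp := norm_integral_prod_fst_mul_sub_sum_le (γ := gaussianReal 0 v) (n := p + 1)
    (by omega) hInt hrec hd hbdd hM (Real.abs_sin_le_one θ) (Real.cos θ)
  have hibp := integral_prod_snd_mul_gaussianReal (ν := ν) (v := v) (hd 0 (by omega))
    (hcont 1 (by omega)) hB hB' (Real.sin θ) (Real.cos θ)
  rw [← hP] at hexp hibp
  have hsplit : ∫ z, ((Real.cos θ * z.1 - Real.sin θ * z.2 : ℝ) : ℂ) *
      φ 0 (Real.sin θ * z.1 + Real.cos θ * z.2) ∂P =
      Real.cos θ * (∫ z, (z.1 : ℂ) * φ 0 (Real.sin θ * z.1 + Real.cos θ * z.2) ∂P) -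
      Real.sin θ * (∫ z, (z.2 : ℂ) * φ 0 (Real.sin θ * z.1 + Real.cos θ * z.2) ∂P) := by
    rw [← integral_const_mul, ← integral_const_mul,
      ← integral_sub (hi1.const_mul _) (hi2.const_mul _)]
    refine integral_congr_ae (ae_of_all _ fun z => ?_)
    simp only [ofReal_sub, ofReal_mul]
    ring
  have hsum : ∀ F : ℕ → ℂ, ∑ j ∈ range (p + 1), F j = F 0 + F 1 + ∑ l ∈ Icc 2 p, F l := by
    intro F
    rw [range_eq_Ico, sum_eq_sum_Ico_succ_bot (by omega), sum_eq_sum_Ico_succ_bot (by omega),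
      ← add_assoc]
    rfl
  rw [hsum] at hexp
  rw [hsplit, hibp]
  refine le_trans (le_of_eq ?_) (mul_le_mul_of_nonneg_left hexp (abs_nonneg (Real.cos θ)))
  rw [← Real.norm_eq_abs, ← norm_real, ← norm_mul, mul_sub, mul_add, mul_add, mul_sum]
  congr 1
  have e : ∀ l ∈ Icc 2 p, (Real.cos θ : ℂ) * (κ (l + 1) / (l.factorial : ℂ) *
      ((Real.sin θ : ℂ) ^ l * ∫ z, φ l (Real.sin θ * z.1 + Real.cos θ * z.2) ∂P)) =
      κ (l + 1) / (l.factorial : ℂ) * (Real.cos θ * (Real.sin θ : ℂ) ^ l *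
          ∫ z, φ l (Real.sin θ * z.1 + Real.cos θ * z.2) ∂P) := fun l _ => by ring
  rw [sum_congr rfl e]
  simp only [zero_add, hκ1, hκ2, Nat.reduceAdd]
  simp
  ring

lemma integral_rpow_mul_comp_sqrt {P : Measure (ℝ × ℝ)} [IsProbabilityMeasure P] {g : ℝ → ℂ}
    (hg : Continuous g) {B : ℝ} (hB : ∀ x, ‖g x‖ ≤ B) {l : ℕ} (hl : 1 ≤ l) :
    ∫ s in (0 : ℝ)..1, ((s ^ (((l : ℝ) - 1) / 2) : ℝ) : ℂ) *
        ∫ z, g (Real.sqrt s * z.1 + Real.sqrt (1 - s) * z.2) ∂P =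
      2 * ∫ θ in (0 : ℝ)..(Real.pi / 2), Real.cos θ * (Real.sin θ : ℂ) ^ l *
        ∫ z, g (Real.sin θ * z.1 + Real.cos θ * z.2) ∂P := by
  have hl' : 0 ≤ ((l : ℝ) - 1) / 2 := by
    have : (1 : ℝ) ≤ l := by exact_mod_cast hl
    linarith
  set h : ℝ → ℂ := fun s => ((s ^ (((l : ℝ) - 1) / 2) : ℝ) : ℂ) *
    ∫ z, g (Real.sqrt s * z.1 + Real.sqrt (1 - s) * z.2) ∂P with hh
  have hcont : Continuous h := by
    refine (continuous_ofReal.comp (Real.continuous_rpow_const hl')).mul ?_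
    exact continuous_of_dominated (bound := fun _ => B)
      (fun s => Continuous.aestronglyMeasurable (by fun_prop)) (fun s => ae_of_all _ fun z => hB _)
      (integrable_const B) (ae_of_all _ fun z => by fun_prop)
  have hsub := intervalIntegral.integral_deriv_smul_comp (a := 0) (b := Real.pi / 2)
    (f := fun θ => Real.sin θ ^ 2) (f' := fun θ => 2 * Real.sin θ * Real.cos θ) (g := h)
    (fun θ _ => by simpa using! (Real.hasDerivAt_sin θ).pow 2) (by fun_prop) hcont
  simp only [Real.sin_zero, Real.sin_pi_div_two] at hsub
  norm_num at hsub
  rw [← hsub, ← intervalIntegral.integral_const_mul]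
  refine intervalIntegral.integral_congr fun θ hθ => ?_
  rw [Set.uIcc_of_le (by positivity)] at hθ
  have hs : 0 ≤ Real.sin θ := Real.sin_nonneg_of_nonneg_of_le_pi hθ.1
    (by linarith [hθ.2, Real.pi_pos])
  have hc : 0 ≤ Real.cos θ := Real.cos_nonneg_of_neg_pi_div_two_le_of_le
    (by linarith [hθ.1, Real.pi_pos]) hθ.2
  have e1 : Real.sqrt (Real.sin θ ^ 2) = Real.sin θ := Real.sqrt_sq hs
  have e2 : Real.sqrt (1 - Real.sin θ ^ 2) = Real.cos θ := by
    rw [← Real.cos_sq', Real.sqrt_sq hc]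
  have e3 : (Real.sin θ ^ 2) ^ (((l : ℝ) - 1) / 2) = Real.sin θ ^ (l - 1) := by
    rw [← Real.rpow_natCast, ← Real.rpow_mul hs, ← Real.rpow_natCast, Nat.cast_sub hl]
    congr 1
    push_cast
    ring
  have e4 : (Real.sin θ : ℂ) ^ l = Real.sin θ ^ (l - 1) * Real.sin θ := by
    rw [← pow_succ, Nat.sub_add_cancel hl]
  simp only [hh, e1, e2, e3, e4]
  push_cast
  ring

/-- Gaussian interpolation: if `ζ` is centered with `E{|ζ|^{p+2}} < ∞` (`p ≥ 2`), `ζ̂` is an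
independent centered Gaussian with the same second moment, `ζ(s) = √s ζ + √(1-s) ζ̂`, and
`Φ ∈ C^{p+2}` has bounded derivatives, then
`E{Φ(ζ)} - E{Φ(ζ̂)} = Σ_{l=2}^p (κ_{l+1}/(2 l!)) ∫₀¹ E{Φ^{(l+1)}(ζ(s))} s^{(l-1)/2} ds + ε'_p`
with `|ε'_p| ≤ C_p E{|ζ|^{p+2}} sup_t |Φ^{(p+2)}(t)|`, `C_p = (1+(3+2p)^{p+2})/(p+1)!`. -/
theorem gaussian_interpolation_expansion
    {Ω : Type*} [MeasureSpace Ω] [IsProbabilityMeasure (ℙ : Measure Ω)]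
    (p : ℕ) (hp : 2 ≤ p) (ζ ζhat : Ω → ℝ)
    (hmeas : Measurable ζ) (hmeashat : Measurable ζhat)
    (hindep : IndepFun ζ ζhat ℙ)
    (hmom : Integrable (fun ω => |ζ ω| ^ (p + 2)))
    (hcen : ∫ ω, ζ ω = 0)
    (v : NNReal) (hgauss : Measure.map ζhat ℙ = gaussianReal 0 v)
    (hvar : ∫ ω, (ζhat ω) ^ 2 = ∫ ω, (ζ ω) ^ 2)
    (Φ : ℝ → ℂ) (hΦ : ContDiff ℝ (p + 2) Φ)
    (hbdd : ∀ l : ℕ, 1 ≤ l → l ≤ p + 2 → ∃ B : ℝ, ∀ t : ℝ, ‖iteratedDeriv l Φ t‖ ≤ B) :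
    ‖((∫ ω, Φ (ζ ω)) - ∫ ω, Φ (ζhat ω))
        - ∑ l ∈ Icc 2 p, cumulant ζ (l + 1) / (2 * (l.factorial : ℂ))
            * ∫ s in (0:ℝ)..1,
                ((s ^ (((l : ℝ) - 1) / 2) : ℝ) : ℂ)
                  * ∫ ω, iteratedDeriv (l + 1) Φ
                      (Real.sqrt s * ζ ω + Real.sqrt (1 - s) * ζhat ω)‖
      ≤ (1 + (3 + 2 * (p : ℝ)) ^ (p + 2)) / ((p + 1).factorial : ℝ)
          * (∫ ω, |ζ ω| ^ (p + 2)) * ⨆ t : ℝ, ‖iteratedDeriv (p + 2) Φ t‖ := by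
  set ν := Measure.map ζ ℙ
  have hνp : IsProbabilityMeasure ν := Measure.isProbabilityMeasure_map hmeas.aemeasurable
  set P := ν.prod (gaussianReal 0 v)
  have hlaw : Measure.map (fun ω => (ζ ω, ζhat ω)) ℙ = P := by
    rw [(indepFun_iff_map_prod_eq_prod_map_map hmeas.aemeasurable hmeashat.aemeasurable).1 hindep,
      hgauss]
  have htr : ∀ {F : ℝ → ℂ}, Continuous F → ∀ a b : ℝ,
      ∫ ω, F (a * ζ ω + b * ζhat ω) = ∫ z, F (a * z.1 + b * z.2) ∂P := by
    intro F hF a b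
    rw [← hlaw, integral_map (hmeas.prodMk hmeashat).aemeasurable
      (Continuous.aestronglyMeasurable (by fun_prop))]
  have hpow : ∀ k : ℕ, ∫ x, x ^ k ∂ν = ∫ ω, ζ ω ^ k := fun k =>
    integral_map hmeas.aemeasurable (Continuous.aestronglyMeasurable (by fun_prop))
  have habs : ∫ x, |x| ^ (p + 2) ∂ν = ∫ ω, |ζ ω| ^ (p + 2) :=
    integral_map hmeas.aemeasurable (Continuous.aestronglyMeasurable (by fun_prop))
  have hInt : Integrable (fun x : ℝ => |x| ^ (p + 2)) ν :=
    (integrable_map_measure (Continuous.aestronglyMeasurable (by fun_prop))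
      hmeas.aemeasurable).2 hmom
  have hcenν : ∫ x, x ∂ν = 0 := by simpa [hcen] using hpow 1
  have hvarν : ∫ x, x ^ 2 ∂ν = v := by
    have h1 : ∫ ω, (ζhat ω) ^ 2 = ∫ x, x ^ 2 ∂(gaussianReal 0 v) := by
      rw [← hgauss, integral_map hmeashat.aemeasurable
        (Continuous.aestronglyMeasurable (by fun_prop))]
    have h2 := variance_of_integral_eq_zero (μ := gaussianReal 0 v) (X := fun x => x)
      (by fun_prop) integral_id_gaussianReal
    rw [variance_fun_id_gaussianReal] at h2
    rw [hpow, ← hvar, h1, h2]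
  have hrec : ∀ r < p + 1, ((∫ x, x ^ (r + 1) ∂ν : ℝ) : ℂ) = ∑ j ∈ range (r + 1),
      (r.choose j : ℂ) * cumulant ζ (j + 1) * ((∫ x, x ^ (r - j) ∂ν : ℝ) : ℂ) := fun r hr =>
    integral_pow_succ_eq_sum_cumulant hmeas (integrable_pow_abs_of_le (by omega) hInt)
  have hcont : ∀ l ≤ p + 2, Continuous (iteratedDeriv l Φ) := fun l hl =>
    hΦ.continuous_iteratedDeriv l (by exact_mod_cast hl)
  have hderiv : ∀ l < p + 2, ∀ x, HasDerivAt (iteratedDeriv l Φ) (iteratedDeriv (l + 1) Φ x) x := by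
    intro l hl x
    rw [iteratedDeriv_succ]
    exact (hΦ.differentiable_iteratedDeriv l (by exact_mod_cast hl) x).hasDerivAt
  set M := ⨆ t : ℝ, ‖iteratedDeriv (p + 2) Φ t‖
  have hM : ∀ x, ‖iteratedDeriv (p + 2) Φ x‖ ≤ M := by
    obtain ⟨B, hB⟩ := hbdd (p + 2) (by omega) le_rfl
    exact le_ciSup (f := fun t : ℝ => ‖iteratedDeriv (p + 2) Φ t‖)
      ⟨B, by rintro _ ⟨t, rfl⟩; exact hB t⟩
  have hM0 : 0 ≤ M := (norm_nonneg _).trans (hM 0)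
  have hi1 : Integrable (fun z : ℝ × ℝ => z.1) P := by
    have := integrable_pow_abs_of_le (k := 1) (by omega) hInt
    have h1 : Integrable (fun x : ℝ => x) ν :=
      (integrable_norm_iff (by fun_prop)).1 (by simpa using this)
    exact h1.comp_fst _
  have hi2 : Integrable (fun z : ℝ × ℝ => z.2) P :=
    Integrable.comp_snd ((memLp_id_gaussianReal 1).integrable (by simp)) ν
  obtain ⟨B, hB⟩ := hbdd 1 le_rfl (by omega)
  set D : ℝ → ℂ := fun θ => ∫ z, ((Real.cos θ * z.1 - Real.sin θ * z.2 : ℝ) : ℂ) *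
    iteratedDeriv 1 Φ (Real.sin θ * z.1 + Real.cos θ * z.2) ∂P
  have hDc : Continuous D := continuous_integral_sin_cos hi1 hi2 (hcont 1 (by omega)) hB
  have hΦ1 : ∀ x, HasDerivAt Φ (iteratedDeriv 1 Φ x) x := by
    simpa only [iteratedDeriv_zero, zero_add] using hderiv 0 (by omega)
  have hftc := intervalIntegral.integral_eq_sub_of_hasDerivAt (a := 0) (b := Real.pi / 2)
    (fun θ _ => hasDerivAt_integral_sin_cos hi1 hi2 hΦ1
      (hcont 1 (by omega)) hB θ)
    (hDc.intervalIntegrable _ _)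
  have hdiff : (∫ ω, Φ (ζ ω)) - ∫ ω, Φ (ζhat ω) = ∫ θ in (0 : ℝ)..(Real.pi / 2), D θ := by
    have h1 := htr hΦ.continuous 1 0
    have h0 := htr hΦ.continuous 0 1
    simp only [one_mul, zero_mul, add_zero, zero_add] at h1 h0
    rw [hftc, h1, h0]
    simp
  set S : ℕ → ℝ → ℂ := fun l θ => cumulant ζ (l + 1) / (l.factorial : ℂ) *
    (Real.cos θ * (Real.sin θ : ℂ) ^ l *
      ∫ z, iteratedDeriv (l + 1) Φ (Real.sin θ * z.1 + Real.cos θ * z.2) ∂P)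
  have hSc : ∀ l ∈ Icc 2 p, Continuous (S l) := by
    intro l hl
    have hl' := mem_Icc.1 hl
    obtain ⟨B, hB⟩ := hbdd (l + 1) (by omega) (by omega)
    have hc := hcont (l + 1) (by omega)
    refine continuous_const.mul (Continuous.mul (by fun_prop) ?_)
    exact continuous_of_dominated (bound := fun _ => B)
      (fun s => Continuous.aestronglyMeasurable (by fun_prop)) (fun s => ae_of_all _ fun z => hB _)
      (integrable_const B) (ae_of_all _ fun z => by fun_prop)
  have hterm : ∀ l ∈ Icc 2 p, cumulant ζ (l + 1) / (2 * (l.factorial : ℂ))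
      * ∫ s in (0:ℝ)..1, ((s ^ (((l : ℝ) - 1) / 2) : ℝ) : ℂ)
          * ∫ ω, iteratedDeriv (l + 1) Φ (Real.sqrt s * ζ ω + Real.sqrt (1 - s) * ζhat ω) =
      ∫ θ in (0 : ℝ)..(Real.pi / 2), S l θ := by
    intro l hl
    have hl' := mem_Icc.1 hl
    obtain ⟨B, hB⟩ := hbdd (l + 1) (by omega) (by omega)
    have hc := hcont (l + 1) (by omega)
    simp only [htr hc]
    rw [integral_rpow_mul_comp_sqrt hc hB (by omega), intervalIntegral.integral_const_mul,
      ← mul_assoc]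
    congr 1
    have : (l.factorial : ℂ) ≠ 0 := by exact_mod_cast l.factorial_ne_zero
    field_simp
  rw [hdiff, sum_congr rfl hterm, ← intervalIntegral.integral_finsetSum
    (fun l hl => (hSc l hl).intervalIntegrable _ _), ← intervalIntegral.integral_sub
    (hDc.intervalIntegrable _ _)
    ((continuous_finsetSum _ hSc).intervalIntegrable _ _)]
  have hm0 : 0 ≤ ∫ x, |x| ^ (p + 2) ∂ν := integral_nonneg fun x => by positivity
  set K := ((p + 2) ^ (p + 2) : ℕ) / ((p + 1).factorial : ℝ) * (∫ x, |x| ^ (p + 2) ∂ν) * M with hK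
  have hbound : ∀ θ ∈ Set.Ioc (0 : ℝ) (Real.pi / 2),
      ‖D θ - ∑ l ∈ Icc 2 p, S l θ‖ ≤ Real.cos θ * K := by
    intro θ hθ
    have hc : 0 ≤ Real.cos θ := Real.cos_nonneg_of_neg_pi_div_two_le_of_le
      (by linarith [hθ.1, Real.pi_pos]) hθ.2
    have h := norm_integral_rotation_sub_sum_le (v := v) (by omega) hInt hrec hcenν hvarν
      (φ := fun l => iteratedDeriv (l + 1) Φ) (fun j hj => hderiv (j + 1) (by omega))
      (fun j hj => hbdd (j + 1) (by omega) (by omega)) hM θ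
    rwa [abs_of_nonneg hc] at h
  refine (intervalIntegral.norm_integral_le_of_norm_le (by positivity)
    (ae_of_all _ hbound) (Continuous.intervalIntegrable (by fun_prop) _ _)).trans ?_
  rw [intervalIntegral.integral_mul_const, integral_cos, ← habs]
  simp only [Real.sin_pi_div_two, Real.sin_zero, sub_zero, one_mul, hK]
  refine mul_le_mul_of_nonneg_right (mul_le_mul_of_nonneg_right
    (div_le_div_of_nonneg_right ?_ (Nat.cast_nonneg _)) hm0) hM0
  have h1 : ((p : ℝ) + 2) ^ (p + 2) ≤ (3 + 2 * (p : ℝ)) ^ (p + 2) :=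
    pow_le_pow_left₀ (by positivity) (by linarith [(Nat.cast_nonneg p : (0 : ℝ) ≤ p)]) _
  push_cast
  linarith
end

section
/- Let w > 0, let ρ_sc be the semicircle density, and let v(t) = ∫_{−2w}^{2w} e^{itλ} ρ_sc(λ) dλ. Fix t₂ ≥ 0. Then the function F₂(t₁, t₂) = v(t₁ + t₂) − v(t₁) v(t₂) is the unique differentiable function of t₁ ∈ [0,∞) satisfying, for all t₁ ≥ 0, F₂(t₁, t₂) + w² ∫₀^{t₁} ∫₀^{t₃} v(t₃ − t₄) F₂(t₄, t₂) dt₄ dt₃ = −w² ∫₀^{t₁} ∫₀^{t₂} v(t₂ − t₄) v(t₃ + t₄) dt₄ dt₃. -/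
open MeasureTheory Complex

/-- The semicircle density `ρ_sc(λ) = (2πw²)⁻¹ √(4w² - λ²)` (which vanishes for `|λ| > 2w`). -/
noncomputable def semicircle (w : ℝ) (lam : ℝ) : ℝ :=
  (2 * Real.pi * w ^ 2)⁻¹ * Real.sqrt (4 * w ^ 2 - lam ^ 2)

/-- `v(t) = ∫_{-2w}^{2w} e^{itλ} ρ_sc(λ) dλ`, the Fourier transform of the semicircle law. -/
noncomputable def scFourier (w : ℝ) (t : ℝ) : ℂ :=
  ∫ lam in (-(2*w))..(2*w), Complex.exp (Complex.I * t * lam) * (semicircle w lam : ℂ)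

theorem hasSum_intervalIntegral_of_norm_le {a b : ℝ} {f : ℕ → ℝ → ℂ} {g : ℝ → ℂ} {u : ℕ → ℝ}
    (hf : ∀ n, Continuous (f n)) (hu : Summable u)
    (hb : ∀ n, ∀ x ∈ Set.uIoc a b, ‖f n x‖ ≤ u n)
    (hg : ∀ x ∈ Set.uIoc a b, HasSum (fun n => f n x) (g x)) :
    HasSum (fun n => ∫ x in a..b, f n x) (∫ x in a..b, g x) :=
  intervalIntegral.hasSum_integral_of_dominated_convergence (fun n _ => u n)
    (fun n => (hf n).aestronglyMeasurable) (fun n => ae_of_all _ (hb n))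
    (ae_of_all _ fun _ _ => hu) (by simp) (ae_of_all _ hg)

theorem integral_sub_pow_mul_pow (a b : ℕ) (t : ℝ) :
    ∫ s in (0:ℝ)..t, ((t - s : ℝ) : ℂ) ^ a / (a.factorial : ℂ) * ((s : ℂ) ^ b / (b.factorial : ℂ))
      = (t : ℂ) ^ (a + b + 1) / ((a + b + 1).factorial : ℂ) := by
  induction a generalizing b with
  | zero =>
    have h : ∀ s : ℝ, HasDerivAt (fun s : ℝ => (s : ℂ) ^ (b + 1) / ((b + 1).factorial : ℂ))
        ((s : ℂ) ^ b / (b.factorial : ℂ)) s := fun s => by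
      have := ((Complex.ofRealCLM.hasDerivAt (x := s)).pow (b + 1)).div_const
        ((b + 1).factorial : ℂ)
      refine this.congr_deriv ?_
      have h1 : (b.factorial : ℂ) ≠ 0 := by exact_mod_cast b.factorial_ne_zero
      have h2 : (b + 1 : ℂ) ≠ 0 := by exact_mod_cast b.succ_ne_zero
      simp [Nat.factorial_succ]
      field_simp
    simp only [pow_zero, Nat.factorial_zero, Nat.cast_one, div_one, one_mul, zero_add]
    rw [intervalIntegral.integral_eq_sub_of_hasDerivAt (fun s _ => h s)
      (by apply Continuous.intervalIntegrable; fun_prop)]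
    simp
  | succ a ih =>
    have key := ih (b + 1)
    have h : ∀ s : ℝ, HasDerivAt (fun s : ℝ => ((t - s : ℝ) : ℂ) ^ (a + 1) / ((a + 1).factorial : ℂ)
          * ((s : ℂ) ^ (b + 1) / ((b + 1).factorial : ℂ)))
        (((t - s : ℝ) : ℂ) ^ (a + 1) / ((a + 1).factorial : ℂ) * ((s : ℂ) ^ b / (b.factorial : ℂ))
          - ((t - s : ℝ) : ℂ) ^ a / (a.factorial : ℂ)
            * ((s : ℂ) ^ (b + 1) / ((b + 1).factorial : ℂ))) s := fun s => by
      have h1 := ((Complex.ofRealCLM.hasDerivAt (x := s)).pow (b + 1)).div_const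
        ((b + 1).factorial : ℂ)
      have h2 := ((((hasDerivAt_id s).const_sub t).ofReal_comp).pow (a + 1)).div_const
        ((a + 1).factorial : ℂ)
      refine (h2.mul h1).congr_deriv ?_
      have h1 : (b.factorial : ℂ) ≠ 0 := by exact_mod_cast b.factorial_ne_zero
      have h2 : (b + 1 : ℂ) ≠ 0 := by exact_mod_cast b.succ_ne_zero
      have h3 : (a.factorial : ℂ) ≠ 0 := by exact_mod_cast a.factorial_ne_zero
      have h4 : (a + 1 : ℂ) ≠ 0 := by exact_mod_cast a.succ_ne_zero
      simp [Nat.factorial_succ]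
      field_simp
      ring
    have hi := intervalIntegral.integral_eq_sub_of_hasDerivAt (a := 0) (b := t) (fun s _ => h s)
      (by apply Continuous.intervalIntegrable; fun_prop)
    rw [intervalIntegral.integral_sub (by apply Continuous.intervalIntegrable; fun_prop)
      (by apply Continuous.intervalIntegrable; fun_prop), key] at hi
    rw [show a + 1 + b + 1 = a + (b + 1) + 1 by ring]
    simpa [sub_eq_zero] using hi

/-- An exponential generating function whose coefficients obey a Catalan-type recursion solves the
corresponding Volterra equation. -/
theorem eq_one_sub_integral_convolution {c : ℕ → ℂ} {v : ℝ → ℂ} {κ : ℂ}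
    (hc : ∀ r : ℝ, Summable fun n => ‖c n‖ * (r ^ n / (n.factorial : ℝ)))
    (hv : ∀ t : ℝ, HasSum (fun n => c n * ((t : ℂ) ^ n / (n.factorial : ℂ))) (v t))
    (h0 : c 0 = 1) (h1 : c 1 = 0)
    (hrec : ∀ n, c (n + 2) = -κ * ∑ p ∈ Finset.HasAntidiagonal.antidiagonal n, c p.1 * c p.2) (t : ℝ) :
    v t = 1 - κ * ∫ s in (0:ℝ)..t, ∫ x in (0:ℝ)..s, v (s - x) * v x := by
  set e : ℕ → ℝ → ℂ := fun n s => c n * ((s : ℂ) ^ n / (n.factorial : ℂ)) with he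
  set u : ℕ → ℝ := fun n => ∑ p ∈ Finset.HasAntidiagonal.antidiagonal n,
    (‖c p.1‖ * (|t| ^ p.1 / (p.1.factorial : ℝ))) * (‖c p.2‖ * (|t| ^ p.2 / (p.2.factorial : ℝ)))
    with hu_def
  have hecont : ∀ n, Continuous (e n) := fun n => by simp only [he]; fun_prop
  have hnn : 0 ≤ fun n : ℕ => ‖c n‖ * (|t| ^ n / (n.factorial : ℝ)) := fun n => by
    simp only [Pi.zero_apply]; positivity
  have hu : Summable u := by
    simpa only [hu_def] using summable_sum_mul_antidiagonal_of_summable_mul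
      (Summable.mul_of_nonneg (hc |t|) (hc |t|) hnn hnn)
  have hen : ∀ n (s : ℝ), ‖e n s‖ = ‖c n‖ * (|s| ^ n / (n.factorial : ℝ)) := fun n s => by
    simp [he]
  have hle : ∀ n (s : ℝ), |s| ≤ |t| → ‖e n s‖ ≤ ‖c n‖ * (|t| ^ n / (n.factorial : ℝ)) :=
    fun n s hs => by rw [hen]; gcongr
  have hcauchy : ∀ s x : ℝ, HasSum
      (fun n => ∑ p ∈ Finset.HasAntidiagonal.antidiagonal n, e p.1 (s - x) * e p.2 x) (v (s - x) * v x) := by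
    intro s x
    have h1 : Summable fun n => ‖e n (s - x)‖ := by simpa only [hen] using hc |s - x|
    have h2 : Summable fun n => ‖e n x‖ := by simpa only [hen] using hc |x|
    have := tsum_mul_tsum_eq_tsum_sum_antidiagonal_of_summable_norm h1 h2
    rw [(hv (s - x)).tsum_eq, (hv x).tsum_eq] at this
    rw [this]
    exact (summable_norm_sum_mul_antidiagonal_of_summable_norm h1 h2).of_norm.hasSum
  have hbound : ∀ n, ∀ s ∈ Set.uIoc 0 t, ∀ x ∈ Set.uIoc 0 s,
      ‖∑ p ∈ Finset.HasAntidiagonal.antidiagonal n, e p.1 (s - x) * e p.2 x‖ ≤ u n := by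
    intro n s hs x hx
    have hs' := Set.abs_sub_left_of_mem_uIcc (Set.uIoc_subset_uIcc hs)
    have hx' := Set.abs_sub_left_of_mem_uIcc (Set.uIoc_subset_uIcc hx)
    have hx'' := Set.abs_sub_right_of_mem_uIcc (Set.uIoc_subset_uIcc hx)
    simp only [sub_zero] at hs' hx' hx''
    refine norm_sum_le_of_le _ fun p _ => ?_
    rw [norm_mul]
    exact mul_le_mul (hle _ _ (hx''.trans hs')) (hle _ _ (hx'.trans hs')) (norm_nonneg _)
      (by positivity)
  have hcont : ∀ n, Continuous fun p : ℝ × ℝ =>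
      ∑ q ∈ Finset.HasAntidiagonal.antidiagonal n, e q.1 (p.1 - p.2) * e q.2 p.2 := fun n => by fun_prop
  have hinner : ∀ s ∈ Set.uIoc 0 t, HasSum
      (fun n => ∫ x in (0:ℝ)..s, ∑ p ∈ Finset.HasAntidiagonal.antidiagonal n, e p.1 (s - x) * e p.2 x)
      (∫ x in (0:ℝ)..s, v (s - x) * v x) := fun s hs =>
    hasSum_intervalIntegral_of_norm_le (fun n => by fun_prop) hu
      (fun n x hx => hbound n s hs x hx) (fun x _ => hcauchy s x)
  have houter : HasSum (fun n => ∫ s in (0:ℝ)..t, ∫ x in (0:ℝ)..s,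
        ∑ p ∈ Finset.HasAntidiagonal.antidiagonal n, e p.1 (s - x) * e p.2 x)
      (∫ s in (0:ℝ)..t, ∫ x in (0:ℝ)..s, v (s - x) * v x) := by
    refine hasSum_intervalIntegral_of_norm_le (fun n => ?_) (hu.mul_right |t|)
      (fun n s hs => ?_) hinner
    · exact intervalIntegral.continuous_parametric_intervalIntegral_of_continuous
        (f := fun s x => ∑ p ∈ Finset.HasAntidiagonal.antidiagonal n, e p.1 (s - x) * e p.2 x) (hcont n)
        continuous_id
    · have hs' := Set.abs_sub_left_of_mem_uIcc (Set.uIoc_subset_uIcc hs)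
      have := intervalIntegral.norm_integral_le_of_norm_le_const (hbound n s hs)
      simp only [sub_zero] at hs' this
      exact this.trans (mul_le_mul_of_nonneg_left hs' (by positivity))
  have hterm : ∀ n (s : ℝ), ∫ x in (0:ℝ)..s,
      ∑ p ∈ Finset.HasAntidiagonal.antidiagonal n, e p.1 (s - x) * e p.2 x
      = (∑ p ∈ Finset.HasAntidiagonal.antidiagonal n, c p.1 * c p.2)
        * ((s : ℂ) ^ (n + 1) / ((n + 1).factorial : ℂ)) := by
    intro n s
    rw [intervalIntegral.integral_finsetSum
      (fun p _ => by apply Continuous.intervalIntegrable; fun_prop), Finset.sum_mul]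
    refine Finset.sum_congr rfl fun p hp => ?_
    rw [← Finset.HasAntidiagonal.mem_antidiagonal.1 hp, ← integral_sub_pow_mul_pow,
      ← intervalIntegral.integral_const_mul]
    refine intervalIntegral.integral_congr fun x _ => ?_
    simp only [he]
    ring
  have hterm' : ∀ n, -κ * ∫ s in (0:ℝ)..t, ∫ x in (0:ℝ)..s,
      ∑ p ∈ Finset.HasAntidiagonal.antidiagonal n, e p.1 (s - x) * e p.2 x = e (n + 2) t := by
    intro n
    have := integral_sub_pow_mul_pow 0 (n + 1) t
    simp only [pow_zero, Nat.factorial_zero, Nat.cast_one, div_one, one_mul, zero_add] at this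
    simp_rw [hterm, intervalIntegral.integral_const_mul, this, he, hrec]
    ring
  have hA := houter.mul_left (-κ)
  simp_rw [hterm'] at hA
  have hB := (hasSum_nat_add_iff' 2).2 (hv t)
  have := hA.unique hB
  simp [Finset.sum_range_succ, h0, h1] at this
  linear_combination -this

theorem continuous_semicircle (w : ℝ) : Continuous (semicircle w) := by
  unfold semicircle; fun_prop

theorem semicircle_nonneg (w x : ℝ) : 0 ≤ semicircle w x := by
  unfold semicircle; positivity

theorem semicircle_neg (w x : ℝ) : semicircle w (-x) = semicircle w x := by
  simp [semicircle]

/-- The moments of the semicircle law. -/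
noncomputable def semicircleMoment (w : ℝ) (n : ℕ) : ℝ :=
  ∫ x in (-(2*w))..(2*w), x ^ n * semicircle w x

theorem semicircleMoment_zero {w : ℝ} (hw : 0 < w) : semicircleMoment w 0 = 1 := by
  have h := intervalIntegral.integral_comp_mul_left (a := -1) (b := 1)
    (fun x => semicircle w x) (c := 2 * w) (by positivity)
  have h2 : ∀ x : ℝ, semicircle w (2 * w * x)
      = (2 * Real.pi * w ^ 2)⁻¹ * (2 * w) * √(1 - x ^ 2) := fun x => by
    rw [semicircle, show 4 * w ^ 2 - (2 * w * x) ^ 2 = (2 * w) ^ 2 * (1 - x ^ 2) by ring,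
      Real.sqrt_mul (by positivity), Real.sqrt_sq (by positivity)]
    ring
  simp_rw [h2, intervalIntegral.integral_const_mul, integral_sqrt_one_sub_sq] at h
  simp only [semicircleMoment, pow_zero, one_mul]
  simp only [mul_neg, mul_one, smul_eq_mul] at h
  have hpi := Real.pi_ne_zero
  field_simp at h
  linarith

theorem semicircleMoment_one (w : ℝ) : semicircleMoment w 1 = 0 := by
  have h := intervalIntegral.integral_comp_neg (a := -(2*w)) (b := 2*w)
    (fun x => x ^ 1 * semicircle w x)
  simp only [semicircle_neg, neg_neg, pow_one, neg_mul, intervalIntegral.integral_neg] at h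
  simp only [semicircleMoment, pow_one]
  linarith

theorem semicircleMoment_add_two {w : ℝ} (hw : 0 < w) (n : ℕ) :
    (n + 4) * semicircleMoment w (n + 2) = 4 * w ^ 2 * (n + 1) * semicircleMoment w n := by
  have hderiv : ∀ x ∈ Set.Ioo (-(2*w)) (2*w), HasDerivAt
      (fun x => x ^ (n + 1) * ((4 * w ^ 2 - x ^ 2) * semicircle w x))
      ((4 * w ^ 2 * (n + 1)) * (x ^ n * semicircle w x)
        - (n + 4) * (x ^ (n + 2) * semicircle w x)) x := by
    intro x hx
    have hpos : 0 < 4 * w ^ 2 - x ^ 2 := by nlinarith [hx.1, hx.2]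
    have hd : HasDerivAt (fun x : ℝ => 4 * w ^ 2 - x ^ 2) (-(2 * x)) x := by
      simpa using (hasDerivAt_pow 2 x).const_sub (4 * w ^ 2)
    have hs := (hd.sqrt hpos.ne').const_mul (2 * Real.pi * w ^ 2)⁻¹
    refine ((hasDerivAt_pow (n + 1) x).mul (hd.mul hs)).congr_deriv ?_
    simp only [semicircle, Pi.mul_apply]
    have hsq : √(4 * w ^ 2 - x ^ 2) ^ 2 = 4 * w ^ 2 - x ^ 2 := Real.sq_sqrt hpos.le
    have hne : √(4 * w ^ 2 - x ^ 2) ≠ 0 := (Real.sqrt_pos.2 hpos).ne'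
    have hq : (4 * w ^ 2 - x ^ 2) * (-(2 * x) / (2 * √(4 * w ^ 2 - x ^ 2)))
        = -x * √(4 * w ^ 2 - x ^ 2) := by
      rw [← mul_div_assoc, div_eq_iff (by positivity)]
      linear_combination (-2 * x) * (-hsq)
    have hq' := congrArg (fun y => (2 * Real.pi * w ^ 2)⁻¹ * x ^ (n + 1) * y) hq
    push_cast
    linear_combination hq'
  have hc := continuous_semicircle w
  have hi := intervalIntegral.integral_eq_sub_of_hasDerivAt_of_le (by linarith)
    (by fun_prop) hderiv (by apply Continuous.intervalIntegrable; fun_prop)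
  rw [intervalIntegral.integral_sub (by apply Continuous.intervalIntegrable; fun_prop)
    (by apply Continuous.intervalIntegrable; fun_prop), intervalIntegral.integral_const_mul,
    intervalIntegral.integral_const_mul] at hi
  have h1 : (4 : ℝ) * w ^ 2 - (2 * w) ^ 2 = 0 := by ring
  simp only [neg_sq, h1, zero_mul, mul_zero, sub_zero] at hi
  unfold semicircleMoment
  linarith

theorem semicircleMoment_odd {w : ℝ} (hw : 0 < w) (n : ℕ) :
    semicircleMoment w (2 * n + 1) = 0 := by
  induction n with
  | zero => exact semicircleMoment_one w
  | succ n ih =>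
    have h := semicircleMoment_add_two hw (2 * n + 1)
    rw [ih, mul_zero] at h
    exact (mul_eq_zero.1 h).resolve_left (by positivity)

theorem succ_succ_mul_catalan_succ (n : ℕ) :
    (n + 2) * catalan (n + 1) = 2 * (2 * n + 1) * catalan n := by
  have h := Nat.succ_mul_centralBinom_succ n
  rw [← succ_mul_catalan_eq_centralBinom, ← succ_mul_catalan_eq_centralBinom] at h
  refine Nat.eq_of_mul_eq_mul_left n.succ_pos ?_
  simp only [Nat.succ_eq_add_one]
  linarith

theorem semicircleMoment_even {w : ℝ} (hw : 0 < w) (n : ℕ) :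
    semicircleMoment w (2 * n) = w ^ (2 * n) * catalan n := by
  induction n with
  | zero => simp [semicircleMoment_zero hw]
  | succ n ih =>
    have h := semicircleMoment_add_two hw (2 * n)
    have hcat : ((n + 2) * catalan (n + 1) : ℝ) = 2 * (2 * n + 1) * catalan n := by
      exact_mod_cast succ_succ_mul_catalan_succ n
    rw [ih] at h
    rw [show 2 * (n + 1) = 2 * n + 2 by ring]
    refine mul_left_cancel₀ (show ((2 * n : ℕ) + 4 : ℝ) ≠ 0 by positivity) ?_
    rw [h]
    push_cast
    linear_combination (-2 * w ^ (2 * n) * w ^ 2) * hcat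

theorem semicircleMoment_recursion {w : ℝ} (hw : 0 < w) (n : ℕ) :
    semicircleMoment w (n + 2)
      = w ^ 2 * ∑ p ∈ Finset.HasAntidiagonal.antidiagonal n, semicircleMoment w p.1 * semicircleMoment w p.2 := by
  rcases Nat.even_or_odd' n with ⟨m, rfl | rfl⟩
  · rw [show 2 * m + 2 = 2 * (m + 1) by ring, semicircleMoment_even hw, catalan_succ']
    have hinj : Set.InjOn (fun p : ℕ × ℕ => (2 * p.1, 2 * p.2)) (Finset.HasAntidiagonal.antidiagonal m) := by
      rintro ⟨a, b⟩ - ⟨c, d⟩ - h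
      simpa using h
    have hsub : (Finset.HasAntidiagonal.antidiagonal m).image (fun p : ℕ × ℕ => (2 * p.1, 2 * p.2))
        ⊆ Finset.HasAntidiagonal.antidiagonal (2 * m) := by
      intro p hp
      simp only [Finset.mem_image, Finset.HasAntidiagonal.mem_antidiagonal] at hp ⊢
      obtain ⟨q, hq, rfl⟩ := hp
      simp only; omega
    rw [← Finset.sum_subset hsub, Finset.sum_image hinj]
    · push_cast
      rw [Finset.mul_sum, Finset.mul_sum]
      refine Finset.sum_congr rfl fun p hp => ?_
      rw [semicircleMoment_even hw, semicircleMoment_even hw, ← Finset.HasAntidiagonal.mem_antidiagonal.1 hp]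
      ring
    · rintro ⟨a, b⟩ hp hnp
      rw [Finset.HasAntidiagonal.mem_antidiagonal] at hp
      simp only at hp
      rcases Nat.even_or_odd' a with ⟨k, rfl | rfl⟩
      · refine absurd ?_ hnp
        simp only [Finset.mem_image, Finset.HasAntidiagonal.mem_antidiagonal]
        exact ⟨(k, m - k), by simp only; omega, by simp only [Prod.mk.injEq, true_and]; omega⟩
      · simp [semicircleMoment_odd hw]
  · rw [show 2 * m + 1 + 2 = 2 * (m + 1) + 1 by ring, semicircleMoment_odd hw]
    rw [Finset.sum_eq_zero, mul_zero]
    rintro ⟨a, b⟩ hp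
    rw [Finset.HasAntidiagonal.mem_antidiagonal] at hp
    simp only at hp
    rcases Nat.even_or_odd' a with ⟨k, rfl | rfl⟩
    · rw [show b = 2 * (m - k) + 1 by omega, semicircleMoment_odd hw, mul_zero]
    · rw [semicircleMoment_odd hw, zero_mul]

theorem abs_semicircle_le (w x : ℝ) : |semicircle w x| ≤ semicircle w 0 := by
  rw [abs_of_nonneg (semicircle_nonneg w x)]
  exact mul_le_mul_of_nonneg_left (Real.sqrt_le_sqrt (by nlinarith [sq_nonneg x])) (by positivity)

theorem abs_le_of_mem_uIoc_neg {r x : ℝ} (hr : 0 ≤ r) (hx : x ∈ Set.uIoc (-r) r) : |x| ≤ r := by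
  rw [Set.uIoc_of_le (by linarith)] at hx
  exact abs_le.2 ⟨hx.1.le, hx.2⟩

theorem abs_semicircleMoment_le {w : ℝ} (hw : 0 < w) (n : ℕ) :
    |semicircleMoment w n| ≤ (2 * w) ^ n * semicircle w 0 * (4 * w) := by
  have h := intervalIntegral.norm_integral_le_of_norm_le_const (a := -(2*w)) (b := 2*w)
    (f := fun x => x ^ n * semicircle w x) (C := (2 * w) ^ n * semicircle w 0) fun x hx => by
      rw [norm_mul, norm_pow, Real.norm_eq_abs, Real.norm_eq_abs]
      exact mul_le_mul (pow_le_pow_left₀ (abs_nonneg _)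
        (abs_le_of_mem_uIoc_neg (by positivity) hx) n) (abs_semicircle_le w x) (abs_nonneg _)
        (by positivity)
  rwa [sub_neg_eq_add, show 2 * w + 2 * w = 4 * w by ring, abs_of_pos (by positivity)] at h

theorem hasSum_scFourier {w : ℝ} (hw : 0 < w) (t : ℝ) :
    HasSum (fun n => (I ^ n * (semicircleMoment w n : ℂ)) * ((t : ℂ) ^ n / (n.factorial : ℂ)))
      (scFourier w t) := by
  have hc := continuous_semicircle w
  have h := hasSum_intervalIntegral_of_norm_le (a := -(2*w)) (b := 2*w)
    (f := fun n x => (I * t * x) ^ n / (n.factorial : ℂ) * (semicircle w x : ℂ))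
    (g := fun x => Complex.exp (I * t * x) * (semicircle w x : ℂ))
    (u := fun n => (|t| * (2 * w)) ^ n / (n.factorial : ℝ) * semicircle w 0)
    (fun n => by fun_prop) ((Real.summable_pow_div_factorial _).mul_right _)
    (fun n x hx => by
      simp only [norm_mul, norm_div, norm_pow, norm_I, norm_real, norm_natCast, one_mul,
        Real.norm_eq_abs]
      have := abs_le_of_mem_uIoc_neg (by positivity) hx
      exact mul_le_mul (by gcongr) (abs_semicircle_le w x) (abs_nonneg _) (by positivity))
    (fun x _ => by
      rw [Complex.exp_eq_exp_ℂ]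
      exact (NormedSpace.expSeries_div_hasSum_exp (I * t * x)).mul_right _)
  rw [scFourier]
  convert h using 2 with n
  have hterm : ∀ x : ℝ, (I * t * x) ^ n / (n.factorial : ℂ) * (semicircle w x : ℂ)
      = I ^ n * ((t : ℂ) ^ n / (n.factorial : ℂ)) * ((x ^ n * semicircle w x : ℝ) : ℂ) :=
    fun x => by push_cast; ring
  simp_rw [hterm, intervalIntegral.integral_const_mul, intervalIntegral.integral_ofReal]
  rw [semicircleMoment]
  ring

theorem summable_norm_semicircleMoment {w : ℝ} (hw : 0 < w) (r : ℝ) :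
    Summable fun n => ‖I ^ n * (semicircleMoment w n : ℂ)‖ * (r ^ n / (n.factorial : ℝ)) := by
  refine Summable.of_norm_bounded
    ((Real.summable_pow_div_factorial (2 * w * |r|)).mul_right (semicircle w 0 * (4 * w)))
    fun n => ?_
  simp only [norm_mul, norm_div, norm_pow, norm_I, norm_real, one_pow, one_mul,
    Real.norm_eq_abs, abs_abs, Nat.abs_cast]
  calc |semicircleMoment w n| * (|r| ^ n / n.factorial)
      ≤ ((2 * w) ^ n * semicircle w 0 * (4 * w)) * (|r| ^ n / n.factorial) := by
        gcongr; exact abs_semicircleMoment_le hw n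
    _ = _ := by ring

theorem continuous_scFourier (w : ℝ) : Continuous (scFourier w) := by
  have hc := continuous_semicircle w
  exact intervalIntegral.continuous_parametric_intervalIntegral_of_continuous'
    (f := fun t lam : ℝ => Complex.exp (I * t * lam) * (semicircle w lam : ℂ)) (by fun_prop) _ _

theorem scFourier_zero {w : ℝ} (hw : 0 < w) : scFourier w 0 = 1 := by
  have := semicircleMoment_zero hw
  simp only [semicircleMoment, pow_zero, one_mul] at this
  simp [scFourier, intervalIntegral.integral_ofReal, this]

theorem scFourier_eq_one_sub {w : ℝ} (hw : 0 < w) (t : ℝ) :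
    scFourier w t = 1 - (w ^ 2 : ℂ) *
      ∫ s in (0:ℝ)..t, ∫ x in (0:ℝ)..s, scFourier w (s - x) * scFourier w x := by
  refine eq_one_sub_integral_convolution (summable_norm_semicircleMoment hw)
    (hasSum_scFourier hw) (by simp [semicircleMoment_zero hw]) (by simp [semicircleMoment_one])
    (fun n => ?_) t
  rw [semicircleMoment_recursion hw, pow_add, I_sq]
  push_cast
  simp only [Finset.mul_sum]
  refine Finset.sum_congr rfl fun p hp => ?_
  rw [← Finset.HasAntidiagonal.mem_antidiagonal.1 hp]
  ring

theorem continuous_integral_comp_sub_mul {f g : ℝ → ℂ} (hf : Continuous f) (hg : Continuous g) :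
    Continuous fun s : ℝ => ∫ x in (0:ℝ)..s, f (s - x) * g x :=
  intervalIntegral.continuous_parametric_intervalIntegral_of_continuous
    (f := fun s x => f (s - x) * g x) (by fun_prop) continuous_id

theorem hasDerivAt_scFourier {w : ℝ} (hw : 0 < w) (t : ℝ) :
    HasDerivAt (scFourier w)
      (-(w ^ 2 : ℂ) * ∫ x in (0:ℝ)..t, scFourier w (t - x) * scFourier w x) t := by
  have hc := continuous_integral_comp_sub_mul (continuous_scFourier w) (continuous_scFourier w)
  have h := ((intervalIntegral.integral_hasDerivAt_right (hc.intervalIntegrable 0 t)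
    (hc.stronglyMeasurableAtFilter _ _) hc.continuousAt).const_mul (w ^ 2 : ℂ)).const_sub 1
  rw [← neg_mul] at h
  exact h.congr_of_eventuallyEq (.of_forall fun s => scFourier_eq_one_sub hw s)

theorem integral_convolution_add (f : ℝ → ℂ) (hf : Continuous f) (a b : ℝ) :
    ∫ x in (0:ℝ)..(a + b), f (a + b - x) * f x
      = (∫ x in (0:ℝ)..a, f (a - x) * f (x + b)) + ∫ x in (0:ℝ)..b, f (b - x) * f (a + x) := by
  have h1 := intervalIntegral.integral_comp_add_right (a := 0) (b := a)
    (fun x => f (a + b - x) * f x) b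
  have h2 := intervalIntegral.integral_comp_sub_left (a := 0) (b := b)
    (fun x => f (a + b - x) * f x) b
  rw [← intervalIntegral.integral_add_adjacent_intervals (b := b)
    (by apply Continuous.intervalIntegrable; fun_prop)
    (by apply Continuous.intervalIntegrable; fun_prop), add_comm]
  simp only [zero_add, sub_zero, sub_self] at h1 h2
  rw [← h1, ← h2]
  congr 1
  · refine intervalIntegral.integral_congr fun x _ => ?_
    simp only [show a + b - (x + b) = a - x by ring]
  · refine intervalIntegral.integral_congr fun x _ => ?_
    simp only [show a + b - (b - x) = a + x by ring, mul_comm]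

theorem hasDerivAt_scFourier_add_sub_mul {w : ℝ} (hw : 0 < w) (t₂ t : ℝ) :
    HasDerivAt (fun t₁ => scFourier w (t₁ + t₂) - scFourier w t₁ * scFourier w t₂)
      (-(w ^ 2 : ℂ) * (∫ x in (0:ℝ)..t, scFourier w (t - x)
          * (scFourier w (x + t₂) - scFourier w x * scFourier w t₂))
        + -(w ^ 2 : ℂ) * ∫ x in (0:ℝ)..t₂, scFourier w (t₂ - x) * scFourier w (t + x)) t := by
  have hc := continuous_scFourier w
  refine (((hasDerivAt_scFourier hw (t + t₂)).comp_add_const t t₂).sub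
    ((hasDerivAt_scFourier hw t).mul_const (scFourier w t₂))).congr_deriv ?_
  simp only [mul_sub, ← mul_assoc]
  rw [integral_convolution_add _ hc, intervalIntegral.integral_sub
    (by apply Continuous.intervalIntegrable; fun_prop)
    (by apply Continuous.intervalIntegrable; fun_prop), intervalIntegral.integral_mul_const]
  ring

/-- A continuous solution of the homogeneous integral equation vanishes. -/
theorem eq_zero_of_eq_mul_integral_convolution {k D : ℝ → ℂ} {κ : ℂ} (hk : Continuous k)
    (hD : Continuous D)
    (h : ∀ t, 0 ≤ t → D t = κ * ∫ s in (0:ℝ)..t, ∫ x in (0:ℝ)..s, k (s - x) * D x)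
    {t : ℝ} (ht : 0 ≤ t) : D t = 0 := by
  obtain ⟨C, hC⟩ := isCompact_Icc.exists_bound_of_continuousOn (s := Set.Icc 0 t) hk.continuousOn
  have hC0 : 0 ≤ C := (norm_nonneg _).trans (hC 0 ⟨le_rfl, ht⟩)
  have hint : ∀ a b, IntervalIntegrable (fun x => ‖D x‖) volume a b :=
    fun a b => hD.norm.intervalIntegrable a b
  have hbound : ∀ s ∈ Set.Icc 0 t, ‖D s‖ ≤ (‖κ‖ * C * t) * ‖∫ x in (0:ℝ)..s, ‖D x‖‖ := by
    intro s hs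
    have hH : 0 ≤ ∫ x in (0:ℝ)..s, ‖D x‖ :=
      intervalIntegral.integral_nonneg hs.1 fun _ _ => norm_nonneg _
    have hin : ∀ y ∈ Set.uIoc 0 s, ‖∫ x in (0:ℝ)..y, k (y - x) * D x‖
        ≤ C * ∫ x in (0:ℝ)..s, ‖D x‖ := by
      intro y hy
      rw [Set.uIoc_of_le hs.1] at hy
      rw [← intervalIntegral.integral_const_mul]
      refine (intervalIntegral.norm_integral_le_of_norm_le (g := fun x => C * ‖D x‖) hy.1.le
        (ae_of_all _ fun x hx => ?_) ((hint _ _).const_mul C)).trans ?_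
      · rw [norm_mul]
        gcongr
        exact hC _ ⟨by linarith [hx.2], by linarith [hx.1, hy.2, hs.2]⟩
      · refine intervalIntegral.integral_mono_interval le_rfl hy.1.le hy.2
          (ae_of_all _ fun x => ?_) ((hint _ _).const_mul C)
        simp only [Pi.zero_apply]; positivity
    have := intervalIntegral.norm_integral_le_of_norm_le_const hin
    rw [sub_zero, abs_of_nonneg hs.1] at this
    rw [h s hs.1, norm_mul, Real.norm_of_nonneg hH]
    calc _ ≤ ‖κ‖ * (C * (∫ x in (0:ℝ)..s, ‖D x‖) * s) := by gcongr
      _ ≤ ‖κ‖ * (C * (∫ x in (0:ℝ)..s, ‖D x‖) * t) := by gcongr; exact hs.2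
      _ = _ := by ring
  have hderiv : ∀ s, HasDerivAt (fun s => ∫ x in (0:ℝ)..s, ‖D x‖) ‖D s‖ s := fun s =>
    intervalIntegral.integral_hasDerivAt_right (hint 0 s)
      (hD.norm.stronglyMeasurableAtFilter _ _) hD.norm.continuousAt
  have hzero := eq_zero_of_abs_deriv_le_mul_abs_self_of_eq_zero_right (a := 0) (b := t)
    (fun s _ => (hderiv s).continuousAt.continuousWithinAt)
    (fun s _ => (hderiv s).hasDerivWithinAt) (by simp)
    (fun s hs => by rw [norm_norm]; exact hbound s ⟨hs.1, hs.2.le⟩) t ⟨ht, le_rfl⟩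
  have := hbound t ⟨ht, le_rfl⟩
  rw [hzero, norm_zero, mul_zero] at this
  exact norm_le_zero_iff.1 this

/-- Uniqueness of continuous solutions on `[0, ∞)` of an integrated Volterra equation. -/
theorem eqOn_of_add_mul_integral_convolution_eq {k F G R : ℝ → ℂ} {κ : ℂ} (hk : Continuous k)
    (hF : ContinuousOn F (Set.Ici 0)) (hG : ContinuousOn G (Set.Ici 0))
    (hFR : ∀ t, 0 ≤ t → F t + κ * ∫ s in (0:ℝ)..t, ∫ x in (0:ℝ)..s, k (s - x) * F x = R t)
    (hGR : ∀ t, 0 ≤ t → G t + κ * ∫ s in (0:ℝ)..t, ∫ x in (0:ℝ)..s, k (s - x) * G x = R t) :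
    Set.EqOn F G (Set.Ici 0) := by
  have hext : ∀ {f : ℝ → ℂ}, ContinuousOn f (Set.Ici 0) → Continuous fun x => f (max x 0) :=
    fun hf => hf.comp_continuous (by fun_prop) fun x => le_max_right x 0
  have hF' := hext hF
  have hG' := hext hG
  have hcongr : ∀ (f : ℝ → ℂ) {t : ℝ}, 0 ≤ t →
      ∫ s in (0:ℝ)..t, ∫ x in (0:ℝ)..s, k (s - x) * f (max x 0)
        = ∫ s in (0:ℝ)..t, ∫ x in (0:ℝ)..s, k (s - x) * f x := by
    intro f t ht
    refine intervalIntegral.integral_congr fun s hs => intervalIntegral.integral_congr fun x hx => ?_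
    rw [Set.uIcc_of_le ht] at hs
    rw [Set.uIcc_of_le hs.1] at hx
    simp only [max_eq_left hx.1]
  intro t ht
  rw [Set.mem_Ici] at ht
  have h := eq_zero_of_eq_mul_integral_convolution (k := k) (κ := -κ)
    (D := fun x => F (max x 0) - G (max x 0)) hk (hF'.sub hG') (fun t ht => ?_) ht
  · simpa only [max_eq_left ht, sub_eq_zero] using h
  have hcF := (continuous_integral_comp_sub_mul hk hF').intervalIntegrable (μ := volume) 0 t
  have hcG := (continuous_integral_comp_sub_mul hk hG').intervalIntegrable (μ := volume) 0 t
  have hsub : ∀ s : ℝ, ∫ x in (0:ℝ)..s, k (s - x) * (F (max x 0) - G (max x 0))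
      = (∫ x in (0:ℝ)..s, k (s - x) * F (max x 0)) - ∫ x in (0:ℝ)..s, k (s - x) * G (max x 0) := by
    intro s
    simp only [mul_sub]
    have hks : Continuous fun x => k (s - x) := by fun_prop
    exact intervalIntegral.integral_sub ((hks.mul hF').intervalIntegrable _ _)
      ((hks.mul hG').intervalIntegrable _ _)
  simp_rw [hsub]
  rw [intervalIntegral.integral_sub hcF hcG, hcongr F ht, hcongr G ht, max_eq_left ht]
  linear_combination hFR t ht - hGR t ht

/-- For fixed `t₂ ≥ 0`, `F₂(t₁,t₂) = v(t₁+t₂) - v(t₁)v(t₂)` is the unique differentiable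
solution on `[0,∞)` of
`F₂(t₁,t₂) + w² ∫₀^{t₁}∫₀^{t₃} v(t₃-t₄)F₂(t₄,t₂) dt₄ dt₃
  = -w² ∫₀^{t₁}∫₀^{t₂} v(t₂-t₄)v(t₃+t₄) dt₄ dt₃`. -/
theorem scFourier_integral_equation_two (w : ℝ) (hw : 0 < w) (t₂ : ℝ) (ht₂ : 0 ≤ t₂) :
    DifferentiableOn ℝ
        (fun t₁ => scFourier w (t₁ + t₂) - scFourier w t₁ * scFourier w t₂) (Set.Ici 0)
    ∧ (∀ t₁ : ℝ, 0 ≤ t₁ →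
        (scFourier w (t₁ + t₂) - scFourier w t₁ * scFourier w t₂)
          + (w ^ 2 : ℂ) * ∫ t₃ in (0:ℝ)..t₁, ∫ t₄ in (0:ℝ)..t₃,
              scFourier w (t₃ - t₄)
                * (scFourier w (t₄ + t₂) - scFourier w t₄ * scFourier w t₂)
          = -(w ^ 2 : ℂ) * ∫ t₃ in (0:ℝ)..t₁, ∫ t₄ in (0:ℝ)..t₂,
              scFourier w (t₂ - t₄) * scFourier w (t₃ + t₄))
    ∧ ∀ G : ℝ → ℂ, DifferentiableOn ℝ G (Set.Ici 0) →
        (∀ t₁ : ℝ, 0 ≤ t₁ →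
          G t₁ + (w ^ 2 : ℂ) * ∫ t₃ in (0:ℝ)..t₁, ∫ t₄ in (0:ℝ)..t₃,
              scFourier w (t₃ - t₄) * G t₄
            = -(w ^ 2 : ℂ) * ∫ t₃ in (0:ℝ)..t₁, ∫ t₄ in (0:ℝ)..t₂,
                scFourier w (t₂ - t₄) * scFourier w (t₃ + t₄)) →
        ∀ t₁ : ℝ, 0 ≤ t₁ →
          G t₁ = scFourier w (t₁ + t₂) - scFourier w t₁ * scFourier w t₂ := by
  have hc := continuous_scFourier w
  have hderiv := hasDerivAt_scFourier_add_sub_mul hw t₂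
  have hdiff : DifferentiableOn ℝ
      (fun t₁ => scFourier w (t₁ + t₂) - scFourier w t₁ * scFourier w t₂) (Set.Ici 0) :=
    fun t _ => (hderiv t).differentiableAt.differentiableWithinAt
  have heq : ∀ t₁ : ℝ, 0 ≤ t₁ →
        (scFourier w (t₁ + t₂) - scFourier w t₁ * scFourier w t₂)
          + (w ^ 2 : ℂ) * ∫ t₃ in (0:ℝ)..t₁, ∫ t₄ in (0:ℝ)..t₃,
              scFourier w (t₃ - t₄)
                * (scFourier w (t₄ + t₂) - scFourier w t₄ * scFourier w t₂)
          = -(w ^ 2 : ℂ) * ∫ t₃ in (0:ℝ)..t₁, ∫ t₄ in (0:ℝ)..t₂,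
              scFourier w (t₂ - t₄) * scFourier w (t₃ + t₄) := by
    intro t₁ _
    have h1 : Continuous fun t : ℝ => ∫ x in (0:ℝ)..t, scFourier w (t - x)
        * (scFourier w (x + t₂) - scFourier w x * scFourier w t₂) :=
      continuous_integral_comp_sub_mul hc (by fun_prop)
    have h2 : Continuous fun t : ℝ => ∫ x in (0:ℝ)..t₂, scFourier w (t₂ - x)
        * scFourier w (t + x) :=
      intervalIntegral.continuous_parametric_intervalIntegral_of_continuous'
        (f := fun t x : ℝ => scFourier w (t₂ - x) * scFourier w (t + x)) (by fun_prop) _ _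
    have h := intervalIntegral.integral_eq_sub_of_hasDerivAt (a := 0) (b := t₁)
      (fun t _ => hderiv t)
      (((h1.const_mul _).add (h2.const_mul _)).intervalIntegrable _ _)
    rw [intervalIntegral.integral_add ((h1.const_mul _).intervalIntegrable _ _)
      ((h2.const_mul _).intervalIntegrable _ _), intervalIntegral.integral_const_mul,
      intervalIntegral.integral_const_mul, scFourier_zero hw, zero_add, one_mul, sub_self,
      sub_zero] at h
    linear_combination -h
  exact ⟨hdiff, heq, fun G hG hGeq t₁ ht₁ =>
    eqOn_of_add_mul_integral_convolution_eq hc hG.continuousOn hdiff.continuousOn hGeq heq ht₁⟩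
end
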